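/- Let Ω ⊆ ℝⁿ, n ≥ 3, be open and bounded, and let u ∈ W^{2,1}_{Δ,0}(Ω) be such that either u ≥ 0 a.e. on Ω, or Ω is a ball centered at the origin and u is radial. Then for every t with 0 < t ≤ |Ω| one has u*(t) ≤ (1/2) · N*_{|Ω|}(t) · ‖Δu‖_{L¹(Ω)}. -/

import Mathlib

open MeasureTheory Filter Topology
open scoped ENNReal

noncomputable section

/-- Euclidean space ℝⁿ. -/
abbrev Euc (n : ℕ) := EuclideanSpace ℝ (Fin n)

/-- The (pointwise) Laplacian of a function on ℝⁿ: the trace of the second derivative. -/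
def lapl (n : ℕ) (φ : Euc n → ℝ) (x : Euc n) : ℝ :=
  ∑ i : Fin n,
    iteratedFDeriv ℝ 2 φ x ![EuclideanSpace.single i (1 : ℝ), EuclideanSpace.single i (1 : ℝ)]

/-- A test function on Ω: smooth and compactly supported inside Ω. -/
def IsTestFun (n : ℕ) (Ω : Set (Euc n)) (φ : Euc n → ℝ) : Prop :=
  ContDiff ℝ (⊤ : ℕ∞) φ ∧ HasCompactSupport φ ∧ tsupport φ ⊆ Ω

/-- `u ∈ W₀^{1,1}(Ω)`: `u` is an L¹(Ω) limit of test functions whose gradients converge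
in L¹(Ω) (i.e. `u` is in the closure of C_c^∞(Ω) in the W^{1,1} norm). -/
def MemW0_1_1 (n : ℕ) (Ω : Set (Euc n)) (u : Euc n → ℝ) : Prop :=
  IntegrableOn u Ω volume ∧
  ∃ φ : ℕ → Euc n → ℝ, (∀ k, IsTestFun n Ω (φ k)) ∧
    Tendsto (fun k => ∫ x in Ω, |φ k x - u x|) atTop (𝓝 0) ∧
    ∃ g : Euc n → Euc n →L[ℝ] ℝ,
      IntegrableOn (fun x => ‖g x‖) Ω volume ∧
      Tendsto (fun k => ∫ x in Ω, ‖fderiv ℝ (φ k) x - g x‖) atTop (𝓝 0)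

/-- `u ∈ W^{2,1}_Δ(Ω)` with distributional Laplacian `f ∈ L¹(Ω)`. -/
def MemW21Delta (n : ℕ) (Ω : Set (Euc n)) (u f : Euc n → ℝ) : Prop :=
  MemW0_1_1 n Ω u ∧ IntegrableOn f Ω volume ∧
    ∀ ψ : Euc n → ℝ, IsTestFun n Ω ψ →
      ∫ x in Ω, u x * lapl n ψ x = ∫ x in Ω, f x * ψ x

/-- `u ∈ W^{2,1}_{Δ,0}(Ω)` with Laplacian `f`: `u` is an L¹(Ω) limit of test functions `φ k`
with `Δ(φ k) → f` in L¹(Ω) (closure of C_c^∞(Ω) in the norm ‖Δu‖₁). -/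
def MemW21Delta0 (n : ℕ) (Ω : Set (Euc n)) (u f : Euc n → ℝ) : Prop :=
  IntegrableOn u Ω volume ∧ IntegrableOn f Ω volume ∧
  ∃ φ : ℕ → Euc n → ℝ, (∀ k, IsTestFun n Ω (φ k)) ∧
    Tendsto (fun k => ∫ x in Ω, |φ k x - u x|) atTop (𝓝 0) ∧
    Tendsto (fun k => ∫ x in Ω, |lapl n (φ k) x - f x|) atTop (𝓝 0)

/-- The decreasing rearrangement `u*(t)` of `u` on Ω. -/
def decRearr (n : ℕ) (Ω : Set (Euc n)) (u : Euc n → ℝ) (t : ℝ) : ℝ :=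
  sInf {s : ℝ | 0 ≤ s ∧ volume {x ∈ Ω | s < |u x|} ≤ ENNReal.ofReal t}

/-- `‖f‖_{L¹(Ω)}`. -/
def L1norm (n : ℕ) (Ω : Set (Euc n)) (f : Euc n → ℝ) : ℝ := ∫ x in Ω, |f x|

/-- ω_{n-1}: surface measure of the unit sphere in ℝⁿ. -/
def omegaS (n : ℕ) : ℝ := 2 * Real.pi ^ ((n : ℝ) / 2) / Real.Gamma ((n : ℝ) / 2)

/-- c_n = 1/((n-2) ω_{n-1}). -/
def cConst (n : ℕ) : ℝ := 1 / (((n : ℝ) - 2) * omegaS n)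

/-- `N*_V(t)`: the rearrangement of the Green function of the ball of volume V. -/
def NstarV (n : ℕ) (V t : ℝ) : ℝ :=
  if n = 2 then (1 / (4 * Real.pi)) * Real.log (V / t)
  else cConst n * (omegaS n / (n : ℝ)) ^ (((n : ℝ) - 2) / (n : ℝ)) *
    (t ^ (-(((n : ℝ) - 2) / (n : ℝ))) - V ^ (-(((n : ℝ) - 2) / (n : ℝ))))

/-- `N*_∞(t)` (for n ≥ 3). -/
def NstarInf (n : ℕ) (t : ℝ) : ℝ :=
  cConst n * (omegaS n / (n : ℝ)) ^ (((n : ℝ) - 2) / (n : ℝ)) *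
    t ^ (-(((n : ℝ) - 2) / (n : ℝ)))

/-- The maximal function `u**(t) = (1/t) ∫₀ᵗ u*(s) ds`. -/
def maximalFn (n : ℕ) (Ω : Set (Euc n)) (u : Euc n → ℝ) (t : ℝ) : ℝ :=
  (1 / t) * ∫ s in (0:ℝ)..t, decRearr n Ω u s

/-- `u ∈ L_exp(Ω)`. -/
def MemLexp (n : ℕ) (Ω : Set (Euc n)) (u : Euc n → ℝ) : Prop :=
  ∃ M : ℝ, ∀ t : ℝ, 0 < t → t ≤ (volume Ω).toReal →
    decRearr n Ω u t / (1 + Real.log ((volume Ω).toReal / t)) ≤ M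

/-- `u ∈ L_{exp,0}(Ω)`. -/
def MemLexp0 (n : ℕ) (Ω : Set (Euc n)) (u : Euc n → ℝ) : Prop :=
  MemLexp n Ω u ∧
    Tendsto (fun t : ℝ => maximalFn n Ω u t / Real.log (1 / t)) (𝓝[>] 0) (𝓝 0)

/-- `u ∈ L^{n/(n-2),∞}(Ω)`. -/
def MemWeakL (n : ℕ) (Ω : Set (Euc n)) (u : Euc n → ℝ) : Prop :=
  ∃ M : ℝ, ∀ t : ℝ, 0 < t → t ≤ (volume Ω).toReal →
    t ^ (((n : ℝ) - 2) / (n : ℝ)) * decRearr n Ω u t ≤ M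

/-- `u ∈ L₀^{n/(n-2),∞}(Ω)`. -/
def MemWeakL0 (n : ℕ) (Ω : Set (Euc n)) (u : Euc n → ℝ) : Prop :=
  MemWeakL n Ω u ∧
    Tendsto (fun t : ℝ => t ^ (((n : ℝ) - 2) / (n : ℝ)) * maximalFn n Ω u t) (𝓝[>] 0) (𝓝 0)

/-- `Λ_n^0(Ω)`: equals `L_{exp,0}(Ω)` if n = 2 and `L₀^{n/(n-2),∞}(Ω)` if n ≥ 3. -/
def MemLambda0 (n : ℕ) (Ω : Set (Euc n)) (u : Euc n → ℝ) : Prop :=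
  if n = 2 then MemLexp0 n Ω u else MemWeakL0 n Ω u

section RearrangementEstimate

open scoped Pointwise

theorem volume_add_volume_le_of_isCompact {K L : Set ℝ} (hK : IsCompact K) (hL : IsCompact L)
    (hK0 : K.Nonempty) (hL0 : L.Nonempty) :
    volume K + volume L ≤ volume (K + L) := by
  obtain ⟨a, haK, ha⟩ := hK.exists_isGreatest hK0
  obtain ⟨b, hbL, hb⟩ := hL.exists_isLeast hL0
  have hsub : ((fun x => x + b) '' K) ∪ ((fun x => a + x) '' (L \ {b})) ⊆ K + L := by
    rintro _ (⟨x, hx, rfl⟩ | ⟨x, hx, rfl⟩)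
    · exact Set.add_mem_add hx hbL
    · exact Set.add_mem_add haK hx.1
  have hdisj : Disjoint ((fun x => x + b) '' K) ((fun x => a + x) '' (L \ {b})) := by
    rw [Set.disjoint_left]
    rintro _ ⟨x, hx, rfl⟩ ⟨y, ⟨hy, hyb⟩, hxy⟩
    have h1 := ha hx
    have h2 := hb hy
    simp only at hxy
    exact hyb (by rw [Set.mem_singleton_iff]; linarith)
  refine le_trans (le_of_eq ?_) (measure_mono hsub)
  rw [measure_union' hdisj (hK.image (by fun_prop)).measurableSet]
  congr 1
  · rw [Set.image_add_right, measure_preimage_add_right]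
  · rw [Set.image_add_left, measure_preimage_add, measure_sdiff_null (by simp)]

theorem exists_isCompact_nonempty_lt_measure {A : Set ℝ} (hA : MeasurableSet A)
    (hA0 : A.Nonempty) {r : ℝ≥0∞} (hr : r < volume A) :
    ∃ K ⊆ A, IsCompact K ∧ K.Nonempty ∧ r ≤ volume K := by
  obtain ⟨K, hKA, hK, h⟩ := hA.exists_lt_isCompact hr
  obtain ⟨a, ha⟩ := hA0
  refine ⟨insert a K, Set.insert_subset ha hKA, hK.insert a, ⟨a, by simp⟩, ?_⟩
  exact h.le.trans (measure_mono (Set.subset_insert _ _))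

/-- The one-dimensional Brunn–Minkowski inequality. -/
theorem volume_add_volume_le {A B : Set ℝ} (hA : MeasurableSet A) (hB : MeasurableSet B)
    (hA0 : A.Nonempty) (hB0 : B.Nonempty) :
    volume A + volume B ≤ volume (A + B) := by
  have key : ∀ K ⊆ A, IsCompact K → K.Nonempty → ∀ L ⊆ B, IsCompact L → L.Nonempty →
      volume K + volume L ≤ volume (A + B) := fun K hKA hK hK0 L hLB hL hL0 =>
    (volume_add_volume_le_of_isCompact hK hL hK0 hL0).trans
      (measure_mono (Set.add_subset_add hKA hLB))
  have key2 : ∀ L ⊆ B, IsCompact L → L.Nonempty → volume A + volume L ≤ volume (A + B) := by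
    intro L hLB hL hL0
    rcases eq_or_ne (volume A) 0 with h0 | h0
    · obtain ⟨a, ha⟩ := hA0
      have := key {a} (by simpa) isCompact_singleton (by simp) L hLB hL hL0
      simpa [h0] using this
    · refine le_of_forall_lt_imp_le_of_dense fun c hc => ?_
      by_cases hcL : c < volume L
      · exact hcL.le.trans (by
          obtain ⟨a, ha⟩ := hA0
          exact le_trans (by simp) (key {a} (by simpa) isCompact_singleton (by simp) L hLB hL hL0))
      · have : c - volume L < volume A := by
          refine ENNReal.sub_lt_of_lt_add (not_lt.1 hcL) hc
        obtain ⟨K, h1, h2, h3, h4⟩ := exists_isCompact_nonempty_lt_measure hA hA0 this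
        calc c ≤ (c - volume L) + volume L := le_tsub_add
          _ ≤ _ := by gcongr
          _ ≤ _ := key K h1 h2 h3 L hLB hL hL0
  rcases eq_or_ne (volume B) 0 with h0 | h0
  · obtain ⟨b, hb⟩ := hB0
    have := key2 {b} (by simpa) isCompact_singleton (by simp)
    simpa [h0] using this
  · refine le_of_forall_lt_imp_le_of_dense fun c hc => ?_
    by_cases hcA : c < volume A
    · obtain ⟨b, hb⟩ := hB0
      exact hcA.le.trans (le_trans (by simp) (key2 {b} (by simpa) isCompact_singleton (by simp)))
    · have : c - volume A < volume B := by
        refine ENNReal.sub_lt_of_lt_add (not_lt.1 hcA) (by rwa [add_comm])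
      obtain ⟨K, h1, h2, h3, h4⟩ := exists_isCompact_nonempty_lt_measure hB hB0 this
      calc c ≤ volume A + (c - volume A) := le_add_tsub
        _ ≤ _ := by gcongr
        _ ≤ _ := key2 K h1 h2 h3

theorem ENNReal.rpow_mul_rpow_le_add {p q : ℝ} (hp : 0 < p) (hq : 0 < q) (hpq : p + q = 1)
    (a b : ℝ≥0∞) : a ^ p * b ^ q ≤ ENNReal.ofReal p * a + ENNReal.ofReal q * b := by
  have h1 : (1 / p).HolderConjugate (1 / q) := by
    rw [Real.holderConjugate_iff]
    refine ⟨(one_lt_div hp).2 (by linarith), by simpa using hpq⟩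
  have := ENNReal.young_inequality (a ^ p) (b ^ q) h1
  rw [← ENNReal.rpow_mul, ← ENNReal.rpow_mul] at this
  simpa [hp.ne', hq.ne', div_eq_mul_inv, mul_comm, ENNReal.ofReal_inv_of_pos, hp, hq] using this

theorem prekopaLeindler_aux {p q : ℝ} (hp : 0 < p) (hq : 0 < q)
    {f g h : ℝ → ℝ} (hf : Measurable f) (hg : Measurable g)
    (hh : Measurable h) (f0 : ∀ x, 0 ≤ f x) (g0 : ∀ x, 0 ≤ g x) (h0 : ∀ x, 0 ≤ h x)
    (f1 : ∀ x, f x ≤ 1) (g1 : ∀ x, g x ≤ 1)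
    (hf1 : ∀ s < 1, ∃ x, s < f x) (hg1 : ∀ s < 1, ∃ x, s < g x)
    (H : ∀ s, 0 ≤ s → ∀ x y, s < f x → s < g y → s < h (p * x + q * y)) :
    ENNReal.ofReal p * (∫⁻ x, ENNReal.ofReal (f x)) + ENNReal.ofReal q * (∫⁻ x, ENNReal.ofReal (g x))
      ≤ ∫⁻ x, ENNReal.ofReal (h x) := by
  rw [lintegral_eq_lintegral_meas_lt _ (ae_of_all _ f0) hf.aemeasurable,
    lintegral_eq_lintegral_meas_lt _ (ae_of_all _ g0) hg.aemeasurable,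
    lintegral_eq_lintegral_meas_lt _ (ae_of_all _ h0) hh.aemeasurable]
  have hmeas : ∀ f : ℝ → ℝ, Measurable fun t : ℝ => volume {a | t < f a} := fun f =>
    Antitone.measurable fun s t hst => measure_mono fun x hx => lt_of_le_of_lt hst hx
  rw [← lintegral_const_mul _ (hmeas f), ← lintegral_const_mul _ (hmeas g),
    ← lintegral_add_left ((hmeas f).const_mul _)]
  refine setLIntegral_mono (hmeas h) fun t ht => ?_
  rcases lt_or_ge t 1 with h1 | h1
  · have e1 : ENNReal.ofReal p * volume {a | t < f a} = volume (p • {a | t < f a}) := by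
      rw [Measure.addHaar_smul]; simp [abs_of_pos hp]
    have e2 : ENNReal.ofReal q * volume {a | t < g a} = volume (q • {a | t < g a}) := by
      rw [Measure.addHaar_smul]; simp [abs_of_pos hq]
    have mf : MeasurableSet {a | t < f a} := measurableSet_lt measurable_const hf
    have mg : MeasurableSet {a | t < g a} := measurableSet_lt measurable_const hg
    rw [e1, e2]
    refine (volume_add_volume_le (mf.const_smul₀ p) (mg.const_smul₀ q) ?_ ?_).trans
      (measure_mono ?_)
    · exact Set.Nonempty.smul_set (hf1 t h1)
    · exact Set.Nonempty.smul_set (hg1 t h1)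
    · rintro _ ⟨_, ⟨x, hx, rfl⟩, _, ⟨y, hy, rfl⟩, rfl⟩
      exact H t ht.le x y hx hy
  · have e1 : {a | t < f a} = ∅ := by
      ext x; simpa using (f1 x).trans h1
    have e2 : {a | t < g a} = ∅ := by
      ext x; simpa using (g1 x).trans h1
    simp [e1, e2]

theorem prekopaLeindler_real_of_bounded {p q : ℝ} (hp : 0 < p) (hq : 0 < q) (hpq : p + q = 1)
    {f g h : ℝ → ℝ≥0∞} (hf : Measurable f) (hg : Measurable g) (hh : Measurable h)
    (hf' : ⨆ x, f x ≠ ⊤) (hg' : ⨆ x, g x ≠ ⊤)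
    (H : ∀ x y, f x ^ p * g y ^ q ≤ h (p * x + q * y)) :
    (∫⁻ x, f x) ^ p * (∫⁻ x, g x) ^ q ≤ ∫⁻ x, h x := by
  set a := ⨆ x, f x with ha
  set b := ⨆ x, g x with hb
  rcases eq_or_ne a 0 with ha0 | ha0
  · have : ∀ x, f x = 0 := by simpa [ha] using ha0
    simp [this, hp]
  rcases eq_or_ne b 0 with hb0 | hb0
  · have : ∀ x, g x = 0 := by simpa [hb] using hb0
    simp [this, hq]
  have hfa : ∀ x, f x / a ≤ 1 := fun x =>
    ENNReal.div_le_of_le_mul (by simpa using le_iSup f x)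
  have hgb : ∀ x, g x / b ≤ 1 := fun x =>
    ENNReal.div_le_of_le_mul (by simpa using le_iSup g x)
  have hfa' : ∀ x, f x / a ≠ ⊤ := fun x => ne_top_of_le_ne_top (by simp) (hfa x)
  have hgb' : ∀ x, g x / b ≠ ⊤ := fun x => ne_top_of_le_ne_top (by simp) (hgb x)
  set c := a ^ p * b ^ q with hc
  have hc0 : c ≠ 0 := by
    simp [hc, ENNReal.rpow_eq_zero_iff, ha0, hb0, hf', hg']
  have hct : c ≠ ⊤ := ENNReal.mul_ne_top (ENNReal.rpow_ne_top_of_nonneg hp.le hf')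
    (ENNReal.rpow_ne_top_of_nonneg hq.le hg')
  have hm : ∀ x, min (h x / c) 1 ≠ ⊤ := fun x => ne_top_of_le_ne_top (by simp) (min_le_right _ _)
  have hsup : ∀ {F : ℝ → ℝ≥0∞}, (⨆ x, F x) ≠ 0 → (⨆ x, F x) ≠ ⊤ →
      (∀ x, F x / (⨆ x, F x) ≠ ⊤) →
      ∀ s < (1 : ℝ), ∃ x, s < (F x / (⨆ x, F x)).toReal := by
    intro F h0 ht hx s hs
    have : ENNReal.ofReal s * (⨆ x, F x) < ⨆ x, F x := by
      conv_rhs => rw [← one_mul (⨆ x, F x)]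
      exact ENNReal.mul_lt_mul_left h0 ht (by simpa using hs)
    obtain ⟨x, hx'⟩ := lt_iSup_iff.1 this
    refine ⟨x, ?_⟩
    rcases lt_or_ge s 0 with hs0 | hs0
    · exact hs0.trans_le ENNReal.toReal_nonneg
    · rw [← ENNReal.ofReal_lt_iff_lt_toReal hs0 (hx x)]
      exact (ENNReal.lt_div_iff_mul_lt (Or.inl h0) (Or.inl ht)).2 hx'
  have key := prekopaLeindler_aux hp hq (f := fun x => (f x / a).toReal)
    (g := fun x => (g x / b).toReal) (h := fun x => (min (h x / c) 1).toReal)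
    (by fun_prop) (by fun_prop) (by fun_prop) (fun x => ENNReal.toReal_nonneg)
    (fun x => ENNReal.toReal_nonneg) (fun x => ENNReal.toReal_nonneg)
    (fun x => ENNReal.toReal_le_of_le_ofReal zero_le_one (by simpa using hfa x))
    (fun x => ENNReal.toReal_le_of_le_ofReal zero_le_one (by simpa using hgb x))
    (hsup ha0 hf' hfa') (hsup hb0 hg' hgb') ?_
  · simp only [ENNReal.ofReal_toReal (hfa' _), ENNReal.ofReal_toReal (hgb' _),
      ENNReal.ofReal_toReal (hm _)] at key
    have k2 : ∫⁻ x, min (h x / c) 1 ≤ ∫⁻ x, h x / c := lintegral_mono fun x => min_le_left _ _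
    have k3 := (ENNReal.rpow_mul_rpow_le_add hp hq hpq _ _).trans (key.trans k2)
    simp only [div_eq_mul_inv] at k3
    rw [lintegral_mul_const _ hf, lintegral_mul_const _ hg, lintegral_mul_const _ hh,
      ← div_eq_mul_inv, ← div_eq_mul_inv, ← div_eq_mul_inv,
      ENNReal.div_rpow_of_nonneg _ _ hp.le, ENNReal.div_rpow_of_nonneg _ _ hq.le,
      ENNReal.le_div_iff_mul_le (Or.inl hc0) (Or.inl hct)] at k3
    refine le_of_eq_of_le ?_ k3
    have e1 : a ^ p ≠ 0 := by simp [ENNReal.rpow_eq_zero_iff, ha0, hf']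
    have e2 : b ^ q ≠ 0 := by simp [ENNReal.rpow_eq_zero_iff, hb0, hg']
    rw [hc, mul_mul_mul_comm, ENNReal.div_mul_cancel e1 (ENNReal.rpow_ne_top_of_nonneg hp.le hf'),
      ENNReal.div_mul_cancel e2 (ENNReal.rpow_ne_top_of_nonneg hq.le hg')]
  · intro s hs x y hx hy
    have h1 : (f x / a) ^ p * (g y / b) ^ q ≤ min (h (p * x + q * y) / c) 1 := by
      refine le_min ?_ ?_
      · rw [ENNReal.div_rpow_of_nonneg _ _ hp.le, ENNReal.div_rpow_of_nonneg _ _ hq.le,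
          ENNReal.le_div_iff_mul_le (Or.inl hc0) (Or.inl hct)]
        have e1 : a ^ p ≠ 0 := by simp [ENNReal.rpow_eq_zero_iff, ha0, hf']
        have e2 : b ^ q ≠ 0 := by simp [ENNReal.rpow_eq_zero_iff, hb0, hg']
        rw [hc, mul_mul_mul_comm,
          ENNReal.div_mul_cancel e1 (ENNReal.rpow_ne_top_of_nonneg hp.le hf'),
          ENNReal.div_mul_cancel e2 (ENNReal.rpow_ne_top_of_nonneg hq.le hg')]
        exact H x y
      · exact mul_le_one' (ENNReal.rpow_le_one (hfa x) hp.le) (ENNReal.rpow_le_one (hgb y) hq.le)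
    have h2 := ENNReal.toReal_mono (hm _) h1
    rw [ENNReal.toReal_mul, ← ENNReal.toReal_rpow, ← ENNReal.toReal_rpow] at h2
    refine lt_of_lt_of_le ?_ h2
    have e1 : s ^ p < (f x / a).toReal ^ p := Real.rpow_lt_rpow hs hx hp
    have e2 : s ^ q < (g y / b).toReal ^ q := Real.rpow_lt_rpow hs hy hq
    calc s = s ^ p * s ^ q := by
          rw [← Real.rpow_add' hs (by rw [hpq]; exact one_ne_zero), hpq, Real.rpow_one]
      _ < _ := mul_lt_mul'' e1 e2 (by positivity) (by positivity)

/-- The one-dimensional Prékopa–Leindler inequality. -/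
theorem prekopaLeindler_real {p q : ℝ} (hp : 0 < p) (hq : 0 < q) (hpq : p + q = 1)
    {f g h : ℝ → ℝ≥0∞} (hf : Measurable f) (hg : Measurable g) (hh : Measurable h)
    (H : ∀ x y, f x ^ p * g y ^ q ≤ h (p * x + q * y)) :
    (∫⁻ x, f x) ^ p * (∫⁻ x, g x) ^ q ≤ ∫⁻ x, h x := by
  have key : ∀ k j : ℕ, (∫⁻ x, min (f x) k) ^ p * (∫⁻ x, min (g x) j) ^ q ≤ ∫⁻ x, h x := by
    intro k j
    refine prekopaLeindler_real_of_bounded hp hq hpq (by fun_prop) (by fun_prop) hh ?_ ?_ ?_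
    · exact ne_top_of_le_ne_top (ENNReal.natCast_ne_top k) (iSup_le fun x => min_le_right _ _)
    · exact ne_top_of_le_ne_top (ENNReal.natCast_ne_top j) (iSup_le fun x => min_le_right _ _)
    · intro x y
      exact le_trans (mul_le_mul' (ENNReal.rpow_le_rpow (min_le_left _ _) hp.le)
        (ENNReal.rpow_le_rpow (min_le_left _ _) hq.le)) (H x y)
  have lim : ∀ {F : ℝ → ℝ≥0∞}, Measurable F → ∀ {r : ℝ}, 0 < r →
      (∫⁻ x, F x) ^ r = ⨆ k : ℕ, (∫⁻ x, min (F x) k) ^ r := by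
    intro F hF r hr
    have e : ∀ x, F x = ⨆ k : ℕ, min (F x) k := fun x => by
      rw [← inf_iSup_eq, ENNReal.iSup_natCast, inf_top_eq]
    conv_lhs => rw [lintegral_congr e]
    rw [lintegral_iSup (fun k => by fun_prop) (fun i j hij x => by gcongr)]
    exact (ENNReal.orderIsoRpow r hr).map_iSup _
  rw [lim hf hp, lim hg hq, ENNReal.iSup_mul]
  refine iSup_le fun k => ?_
  rw [ENNReal.mul_iSup]
  exact iSup_le fun j => key k j

/-- The Prékopa–Leindler inequality on `ℝⁿ`. -/
theorem prekopaLeindler {p q : ℝ} (hp : 0 < p) (hq : 0 < q) (hpq : p + q = 1) (n : ℕ)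
    {f g h : (Fin n → ℝ) → ℝ≥0∞} (hf : Measurable f) (hg : Measurable g) (hh : Measurable h)
    (H : ∀ x y, f x ^ p * g y ^ q ≤ h (p • x + q • y)) :
    (∫⁻ x, f x) ^ p * (∫⁻ x, g x) ^ q ≤ ∫⁻ x, h x := by
  induction n with
  | zero =>
    have e : ∀ F : (Fin 0 → ℝ) → ℝ≥0∞, ∫⁻ x, F x = F 0 := fun F => by
      rw [lintegral_unique]
      simp [volume_pi, Subsingleton.elim default ![]]
    simpa [e] using H 0 0
  | succ n ih =>
    have e : ∀ F : (Fin (n + 1) → ℝ) → ℝ≥0∞, Measurable F →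
        ∫⁻ x, F x = ∫⁻ s : ℝ, ∫⁻ x : Fin n → ℝ, F (Fin.cons s x) := fun F hF => by
      have := (volume_preserving_piFinSuccAbove (fun _ : Fin (n + 1) => ℝ) 0).symm
      rw [← this.lintegral_comp hF, Measure.volume_eq_prod, lintegral_prod _ (by fun_prop)]
      simp only [MeasurableEquiv.piFinSuccAbove_symm_apply, Fin.insertNthEquiv_zero]
      rfl
    have hm : ∀ F : (Fin (n + 1) → ℝ) → ℝ≥0∞, Measurable F →
        Measurable fun z : ℝ × (Fin n → ℝ) => F (Fin.cons z.1 z.2) := fun F hF => by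
      have := (MeasurableEquiv.piFinSuccAbove (fun _ : Fin (n + 1) => ℝ) 0).symm.measurable
      convert hF.comp this using 1
      ext z
      simp only [Function.comp, MeasurableEquiv.piFinSuccAbove_symm_apply,
        Fin.insertNthEquiv_zero]
      rfl
    rw [e f hf, e g hg, e h hh]
    refine prekopaLeindler_real hp hq hpq (hm f hf).lintegral_prod_right'
      (hm g hg).lintegral_prod_right' (hm h hh).lintegral_prod_right' fun s t => ?_
    refine ih ((hm f hf).comp measurable_prodMk_left) ((hm g hg).comp measurable_prodMk_left)
      ((hm h hh).comp measurable_prodMk_left) fun x y => ?_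
    refine (H _ _).trans (le_of_eq ?_)
    congr 1
    ext i
    refine Fin.cases ?_ (fun i => ?_) i <;> simp

/-- The Brunn–Minkowski inequality in multiplicative form. -/
theorem volume_rpow_mul_volume_rpow_le {p q : ℝ} (hp : 0 < p) (hq : 0 < q) (hpq : p + q = 1)
    {n : ℕ} {A B C : Set (EuclideanSpace ℝ (Fin n))} (hA : MeasurableSet A) (hB : MeasurableSet B)
    (hC : MeasurableSet C) (H : ∀ x ∈ A, ∀ y ∈ B, p • x + q • y ∈ C) :
    volume A ^ p * volume B ^ q ≤ volume C := by
  have mp := PiLp.volume_preserving_toLp (Fin n)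
  have e : ∀ S : Set (EuclideanSpace ℝ (Fin n)), MeasurableSet S →
      volume S = ∫⁻ x : Fin n → ℝ, (S.indicator 1 (WithLp.toLp 2 x) : ℝ≥0∞) := fun S hS => by
    rw [mp.lintegral_comp (measurable_one.indicator hS), lintegral_indicator_one hS]
  rw [e A hA, e B hB, e C hC]
  have hm : ∀ S : Set (EuclideanSpace ℝ (Fin n)), MeasurableSet S →
      Measurable fun x : Fin n → ℝ => (S.indicator 1 (WithLp.toLp 2 x) : ℝ≥0∞) := fun S hS =>
    (measurable_one.indicator hS).comp mp.measurable
  refine prekopaLeindler hp hq hpq n (hm A hA) (hm B hB) (hm C hC) fun x y => ?_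
  by_cases hx : WithLp.toLp 2 x ∈ A
  · by_cases hy : WithLp.toLp 2 y ∈ B
    · have := H _ hx _ hy
      simp [hx, hy, this]
    · simp [hy, hq]
  · simp [hx, hp]

/-- The Brunn–Minkowski inequality. -/
theorem volume_real_rpow_add_le {n : ℕ} {A B : Set (EuclideanSpace ℝ (Fin n))}
    (hA : MeasurableSet A) (hB : MeasurableSet B) (hAB : MeasurableSet (A + B))
    {a b : ℝ} (ha : 0 < a) (hb : 0 < b) (hAa : ENNReal.ofReal (a ^ n) ≤ volume A)
    (hBb : ENNReal.ofReal (b ^ n) ≤ volume B) :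
    ENNReal.ofReal ((a + b) ^ n) ≤ volume (A + B) := by
  set S := a + b with hS
  have hS0 : 0 < S := by positivity
  set p := a / S with hp
  set q := b / S with hq
  have hp0 : 0 < p := by positivity
  have hq0 : 0 < q := by positivity
  have hpq : p + q = 1 := by rw [hp, hq, ← add_div, div_self hS0.ne']
  have key := volume_rpow_mul_volume_rpow_le hp0 hq0 hpq (hA.const_smul₀ p⁻¹) (hB.const_smul₀ q⁻¹)
    hAB ?_
  · refine le_trans ?_ key
    have h1 : ENNReal.ofReal (S ^ n) ≤ volume (p⁻¹ • A) := by
      rw [Measure.addHaar_smul, finrank_euclideanSpace_fin, abs_of_pos (by positivity)]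
      calc ENNReal.ofReal (S ^ n) = ENNReal.ofReal (p⁻¹ ^ n) * ENNReal.ofReal (a ^ n) := by
            rw [← ENNReal.ofReal_mul (by positivity), ← mul_pow, hp, inv_div, div_mul_cancel₀ _ ha.ne']
        _ ≤ _ := by gcongr
    have h2 : ENNReal.ofReal (S ^ n) ≤ volume (q⁻¹ • B) := by
      rw [Measure.addHaar_smul, finrank_euclideanSpace_fin, abs_of_pos (by positivity)]
      calc ENNReal.ofReal (S ^ n) = ENNReal.ofReal (q⁻¹ ^ n) * ENNReal.ofReal (b ^ n) := by
            rw [← ENNReal.ofReal_mul (by positivity), ← mul_pow, hq, inv_div, div_mul_cancel₀ _ hb.ne']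
        _ ≤ _ := by gcongr
    calc ENNReal.ofReal (S ^ n) = ENNReal.ofReal (S ^ n) ^ p * ENNReal.ofReal (S ^ n) ^ q := by
          rw [← ENNReal.rpow_add _ _ (by positivity) (by simp), hpq, ENNReal.rpow_one]
      _ ≤ _ := by gcongr
  · rintro _ ⟨x, hx, rfl⟩ _ ⟨y, hy, rfl⟩
    rw [smul_inv_smul₀ hp0.ne', smul_inv_smul₀ hq0.ne']
    exact Set.add_mem_add hx hy

theorem volume_add_ofReal_le_volume_add_ball {n : ℕ} (hn : n ≠ 0)
    {A : Set (EuclideanSpace ℝ (Fin n))} (hA : IsOpen A) (hAt : volume A ≠ ⊤) {a k h : ℝ}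
    (ha : 0 < a) (hk : 0 < k) (hh : 0 < h) (hAa : ENNReal.ofReal (a ^ n) ≤ volume A)
    (hkn : volume (Metric.ball (0 : EuclideanSpace ℝ (Fin n)) 1) = ENNReal.ofReal (k ^ n)) :
    volume A + ENNReal.ofReal (h * (n * k * a ^ (n - 1))) ≤ volume (A + Metric.ball 0 h) := by
  have : Nonempty (Fin n) := Fin.pos_iff_nonempty.1 (Nat.pos_of_ne_zero hn)
  have hB : volume (Metric.ball (0 : EuclideanSpace ℝ (Fin n)) h) = ENNReal.ofReal ((h * k) ^ n) := by
    rw [Measure.addHaar_ball _ _ hh.le, hkn, finrank_euclideanSpace_fin,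
      ← ENNReal.ofReal_mul (by positivity), mul_pow]
  set b := (volume A).toReal ^ (1 / n : ℝ) with hb
  have hbn : b ^ n = (volume A).toReal := by
    rw [hb, one_div, Real.rpow_inv_natCast_pow ENNReal.toReal_nonneg hn]
  have hb0 : 0 ≤ b := by positivity
  have hab : a ≤ b := by
    rw [← pow_le_pow_iff_left₀ ha.le hb0 hn, hbn]
    exact (ENNReal.ofReal_le_iff_le_toReal hAt).1 hAa
  have hbA : ENNReal.ofReal (b ^ n) = volume A := by rw [hbn, ENNReal.ofReal_toReal hAt]
  refine le_trans ?_ (volume_real_rpow_add_le hA.measurableSet Metric.isOpen_ball.measurableSet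
    (hA.add_right).measurableSet (ha.trans_le hab) (mul_pos hh hk) hbA.le hB.ge)
  rw [← hbA, ← ENNReal.ofReal_add (by positivity) (by positivity)]
  refine ENNReal.ofReal_le_ofReal ?_
  have h1 : b ^ n + n * b ^ (n - 1) * (h * k) ≤ (b + h * k) ^ n := by
    have hx : (0:ℝ) ≤ h * k := by positivity
    exact pow_add_mul_le_add_pow hb0 (by positivity) n
  refine le_trans ?_ h1
  have : a ^ (n - 1) ≤ b ^ (n - 1) := by gcongr
  have h2 : 0 ≤ h * k * n := by positivity
  nlinarith [mul_le_mul_of_nonneg_left this h2]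

theorem mul_le_integral_norm_fderiv {n : ℕ} (hn : n ≠ 0)
    {f : EuclideanSpace ℝ (Fin n) → ℝ} (hf : ContDiff ℝ 1 f) (hfc : HasCompactSupport f)
    (hf0 : ∀ x, 0 ≤ f x) {a k L : ℝ} (ha : 0 < a) (hk : 0 < k) (hL : 0 ≤ L)
    (hfL : ENNReal.ofReal (a ^ n) ≤ volume {x | L ≤ f x})
    (hkn : volume (Metric.ball (0 : EuclideanSpace ℝ (Fin n)) 1) = ENNReal.ofReal (k ^ n)) :
    n * k * a ^ (n - 1) * L ≤ ∫ x, ‖fderiv ℝ f x‖ := by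
  have hdc : Continuous (fderiv ℝ f) := hf.continuous_fderiv one_ne_zero
  have hds : HasCompactSupport (fderiv ℝ f) := hfc.fderiv (𝕜 := ℝ)
  have hdi : Integrable (fun x => ‖fderiv ℝ f x‖) :=
    (hdc.integrable_of_hasCompactSupport hds).norm
  have hfi : Integrable f := hf.continuous.integrable_of_hasCompactSupport hfc
  set K := Metric.cthickening 1 (tsupport f) with hK
  have hKc : IsCompact K := hfc.isCompact.cthickening
  have key : ∀ ε > 0, n * k * a ^ (n - 1) * L ≤ (∫ x, ‖fderiv ℝ f x‖) + ε * volume.real K := by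
    intro ε hε
    obtain ⟨δ, hδ, hu⟩ := Metric.uniformContinuous_iff.1
      (hds.uniformContinuous_of_continuous hdc) ε hε
    set h := min δ 1 with hh
    have hh0 : 0 < h := lt_min hδ one_pos
    set g : EuclideanSpace ℝ (Fin n) → ℝ := K.indicator fun x => ‖fderiv ℝ f x‖ + ε with hg
    have hg0 : ∀ x, 0 ≤ g x := fun x => Set.indicator_nonneg (fun x _ => by positivity) x
    have hgi : Integrable g := by
      rw [hg, integrable_indicator_iff hKc.measurableSet]
      exact hdi.integrableOn.add (integrableOn_const hKc.measure_lt_top.ne)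
    have hGi : Integrable fun x => f x + h * g x := hfi.add (hgi.const_mul h)
    have hsub : ∀ τ, 0 ≤ τ → {x | τ < f x} + Metric.ball 0 h ⊆ {x | τ < f x + h * g x} := by
      rintro τ hτ _ ⟨y, hy, z, hz, rfl⟩
      simp only [Set.mem_ofPred_eq] at hy ⊢
      rw [mem_ball_zero_iff] at hz
      have hyK : y ∈ tsupport f := subset_tsupport f (ne_of_gt (hτ.trans_lt hy))
      have hxK : y + z ∈ K := by
        refine Metric.mem_cthickening_of_dist_le _ y _ _ hyK ?_
        rw [dist_self_add_left]
        exact hz.le.trans (min_le_right _ _)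
      have hmv := Convex.norm_image_sub_le_of_norm_fderiv_le (𝕜 := ℝ) (f := f)
        (s := Metric.ball (y + z) h) (C := ‖fderiv ℝ f (y + z)‖ + ε) (x := y + z) (y := y)
        (fun x _ => hf.differentiable one_ne_zero x)
        (fun x hx => by
          have := hu (Metric.mem_ball.1 hx |>.trans_le (min_le_left _ _))
          rw [dist_eq_norm] at this
          linarith [norm_le_norm_add_norm_sub' (fderiv ℝ f x) (fderiv ℝ f (y + z))])
        (convex_ball _ _) (Metric.mem_ball_self hh0) (by
          rw [Metric.mem_ball, dist_self_add_right]; exact hz)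
      have e : ‖y - (y + z)‖ = ‖z‖ := by rw [← dist_eq_norm, dist_self_add_right]
      rw [e] at hmv
      rw [hg, Set.indicator_of_mem hxK]
      have h3 : (‖fderiv ℝ f (y + z)‖ + ε) * ‖z‖ ≤ h * (‖fderiv ℝ f (y + z)‖ + ε) := by
        rw [mul_comm]; gcongr
      have := le_abs_self (f y - f (y + z))
      rw [Real.norm_eq_abs] at hmv
      linarith
    set c := n * k * a ^ (n - 1) with hc
    have hc0 : 0 ≤ c := by positivity
    have h1 : (∫⁻ x, ENNReal.ofReal (f x)) + ENNReal.ofReal (h * c) * ENNReal.ofReal L ≤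
        ∫⁻ x, ENNReal.ofReal (f x + h * g x) := by
      rw [lintegral_eq_lintegral_meas_lt _ (ae_of_all _ hf0) hf.continuous.aemeasurable,
        lintegral_eq_lintegral_meas_lt _ (ae_of_all _ fun x =>
          add_nonneg (hf0 x) (mul_nonneg hh0.le (hg0 x))) hGi.aemeasurable]
      have hmeas : ∀ f : EuclideanSpace ℝ (Fin n) → ℝ,
          Measurable fun t : ℝ => volume {a | t < f a} := fun f =>
        Antitone.measurable fun s t hst => measure_mono fun x hx => lt_of_le_of_lt hst hx
      have e : ENNReal.ofReal (h * c) * ENNReal.ofReal L =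
          ∫⁻ τ in Set.Ioi (0 : ℝ), (Set.Iio L).indicator (fun _ => ENNReal.ofReal (h * c)) τ := by
        rw [lintegral_indicator measurableSet_Iio, setLIntegral_const,
          Measure.restrict_apply measurableSet_Iio, Set.Iio_inter_Ioi, Real.volume_Ioo, sub_zero]
      rw [e, ← lintegral_add_left (hmeas f)]
      refine setLIntegral_mono (hmeas _) fun τ hτ => ?_
      rcases lt_or_ge τ L with hτL | hτL
      · rw [Set.indicator_of_mem (by exact hτL)]
        refine le_trans (volume_add_ofReal_le_volume_add_ball hn
          (isOpen_lt continuous_const hf.continuous) ?_ ha hk hh0 ?_ hkn)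
          (measure_mono (hsub τ (le_of_lt hτ)))
        · refine ne_top_of_le_ne_top hfc.isCompact.measure_lt_top.ne (measure_mono ?_)
          exact fun x hx => subset_tsupport f (ne_of_gt (lt_trans hτ hx))
        · exact hfL.trans (measure_mono fun x hx => lt_of_lt_of_le hτL hx)
      · rw [Set.indicator_of_notMem (by simpa using hτL), add_zero]
        exact measure_mono fun x hx => lt_of_lt_of_le hx
          (le_add_of_nonneg_right (mul_nonneg hh0.le (hg0 x)))
    rw [← ofReal_integral_eq_lintegral_ofReal hfi (ae_of_all _ hf0),
      ← ofReal_integral_eq_lintegral_ofReal hGi (ae_of_all _ fun x =>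
          add_nonneg (hf0 x) (mul_nonneg hh0.le (hg0 x))), ← ENNReal.ofReal_mul (by positivity),
      ← ENNReal.ofReal_add (integral_nonneg hf0) (by positivity), ENNReal.ofReal_le_ofReal_iff
        (integral_nonneg fun x => add_nonneg (hf0 x) (mul_nonneg hh0.le (hg0 x))),
      integral_add hfi (hgi.const_mul h), integral_const_mul] at h1
    have h2 : ∫ x, g x ≤ (∫ x, ‖fderiv ℝ f x‖) + ε * volume.real K := by
      rw [hg, integral_indicator hKc.measurableSet, integral_add hdi.integrableOn
        (integrableOn_const hKc.measure_lt_top.ne), setIntegral_const, smul_eq_mul, mul_comm ε]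
      refine add_le_add_left ?_ _
      exact setIntegral_le_integral hdi (ae_of_all _ fun x => norm_nonneg _)
    refine le_trans ?_ h2
    have h3 : h * (c * L) ≤ h * ∫ x, g x := by linarith
    exact le_of_mul_le_mul_left h3 hh0
  refine ge_of_tendsto (x := 𝓝[>] (0 : ℝ)) (f := fun ε => (∫ x, ‖fderiv ℝ f x‖) + ε * volume.real K)
    ?_ (eventually_mem_nhdsWithin.mono key)
  refine tendsto_nhdsWithin_of_tendsto_nhds ?_
  have : Continuous fun ε : ℝ => (∫ x, ‖fderiv ℝ f x‖) + ε * volume.real K := by fun_prop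
  simpa using this.tendsto 0

theorem lapl_eq_sum_fderiv {n : ℕ} {φ : Euc n → ℝ} (hφ : ContDiff ℝ 2 φ) (x : Euc n) :
    lapl n φ x = ∑ i, fderiv ℝ (fun y => fderiv ℝ φ y (EuclideanSpace.single i 1)) x
      (EuclideanSpace.single i 1) := by
  refine Finset.sum_congr rfl fun i _ => ?_
  have h : DifferentiableAt ℝ (fderiv ℝ φ) x :=
    (hφ.fderiv_right (m := 1) (by norm_num)).differentiable one_ne_zero x
  rw [iteratedFDeriv_two_apply, fderiv_clm_apply h (differentiableAt_const _)]
  simp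

theorem contDiff_fderiv_single {n : ℕ} {φ : Euc n → ℝ} (hφ : ContDiff ℝ 2 φ) (i : Fin n) :
    ContDiff ℝ 1 fun y => fderiv ℝ φ y (EuclideanSpace.single i 1) :=
  (hφ.fderiv_right (m := 1) (by norm_num)).clm_apply contDiff_const

theorem continuous_lapl {n : ℕ} {φ : Euc n → ℝ} (hφ : ContDiff ℝ 2 φ) :
    Continuous (lapl n φ) := by
  rw [funext (lapl_eq_sum_fderiv hφ)]
  exact continuous_finsetSum _ fun i _ =>
    ((contDiff_fderiv_single hφ i).continuous_fderiv one_ne_zero).clm_apply continuous_const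

theorem hasCompactSupport_lapl {n : ℕ} {φ : Euc n → ℝ} (hφc : HasCompactSupport φ) :
    HasCompactSupport (lapl n φ) := by
  refine hφc.mono' fun x hx => ?_
  contrapose! hx
  have h : iteratedFDeriv ℝ 2 φ x = 0 := by
    by_contra h
    exact hx (support_iteratedFDeriv_subset 2 h)
  simp [lapl, h]

/-- Green's first identity. -/
theorem integral_lapl_mul {n : ℕ} {φ ψ : Euc n → ℝ} (hφ : ContDiff ℝ 2 φ) (hψ : ContDiff ℝ 1 ψ)
    (h : HasCompactSupport φ ∨ HasCompactSupport ψ) :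
    ∫ x, lapl n φ x * ψ x = -∫ x, ∑ i, fderiv ℝ φ x (EuclideanSpace.single i 1) *
      fderiv ℝ ψ x (EuclideanSpace.single i 1) := by
  have c1 : ∀ i, Continuous fun y => fderiv ℝ φ y (EuclideanSpace.single i (1 : ℝ)) := fun i =>
    (contDiff_fderiv_single hφ i).continuous
  have c2 : ∀ i, Continuous fun y => fderiv ℝ ψ y (EuclideanSpace.single i (1 : ℝ)) := fun i =>
    (hψ.continuous_fderiv one_ne_zero).clm_apply continuous_const
  have c3 : ∀ i, Continuous fun x => fderiv ℝ (fun y => fderiv ℝ φ y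
      (EuclideanSpace.single i (1 : ℝ))) x (EuclideanSpace.single i 1) := fun i =>
    ((contDiff_fderiv_single hφ i).continuous_fderiv one_ne_zero).clm_apply continuous_const
  have s1 : ∀ i, HasCompactSupport φ → HasCompactSupport fun y =>
      fderiv ℝ φ y (EuclideanSpace.single i (1 : ℝ)) := fun i h => h.fderiv_apply (𝕜 := ℝ) _
  have i1 : ∀ i, Integrable fun x => fderiv ℝ φ x (EuclideanSpace.single i (1 : ℝ)) *
      fderiv ℝ ψ x (EuclideanSpace.single i 1) := fun i => by
    refine ((c1 i).mul (c2 i)).integrable_of_hasCompactSupport ?_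
    rcases h with h | h
    · exact (s1 i h).mul_right
    · exact (h.fderiv_apply (𝕜 := ℝ) _).mul_left
  have i2 : ∀ i, Integrable fun x => ψ x * fderiv ℝ (fun y => fderiv ℝ φ y
      (EuclideanSpace.single i (1 : ℝ))) x (EuclideanSpace.single i 1) := fun i => by
    refine (hψ.continuous.mul (c3 i)).integrable_of_hasCompactSupport ?_
    rcases h with h | h
    · exact ((s1 i h).fderiv_apply (𝕜 := ℝ) _).mul_left
    · exact h.mul_right
  have i3 : ∀ i, Integrable fun x => ψ x * fderiv ℝ φ x (EuclideanSpace.single i (1 : ℝ)) :=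
      fun i => by
    refine (hψ.continuous.mul (c1 i)).integrable_of_hasCompactSupport ?_
    rcases h with h | h
    · exact (s1 i h).mul_left
    · exact h.mul_right
  simp_rw [lapl_eq_sum_fderiv hφ, Finset.sum_mul]
  rw [integral_finsetSum _ fun i _ => by simpa only [mul_comm] using i2 i,
    integral_finsetSum _ fun i _ => i1 i, ← Finset.sum_neg_distrib]
  refine Finset.sum_congr rfl fun i _ => ?_
  have := integral_mul_fderiv_eq_neg_fderiv_mul_of_integrable (μ := (volume : Measure (Euc n)))
    (f := ψ) (g := fun x => fderiv ℝ φ x (EuclideanSpace.single i (1 : ℝ)))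
    (v := EuclideanSpace.single i (1 : ℝ)) (by simpa only [mul_comm] using i1 i) (i2 i) (i3 i)
    (fun x _ => hψ.differentiable one_ne_zero x)
    (fun x _ => (contDiff_fderiv_single hφ i).differentiable one_ne_zero x)
  simpa only [mul_comm] using this

theorem integral_lapl_eq_zero {n : ℕ} {φ : Euc n → ℝ} (hφ : ContDiff ℝ 2 φ)
    (h : HasCompactSupport φ) : ∫ x, lapl n φ x = 0 := by
  simpa using integral_lapl_mul hφ (contDiff_const (c := (1 : ℝ))) (Or.inl h)

/-- Green's second identity. -/
theorem integral_lapl_mul_comm {n : ℕ} {φ ψ : Euc n → ℝ} (hφ : ContDiff ℝ 2 φ)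
    (hψ : ContDiff ℝ 2 ψ) (h : HasCompactSupport φ) :
    ∫ x, lapl n φ x * ψ x = ∫ x, φ x * lapl n ψ x := by
  rw [integral_lapl_mul hφ (hψ.of_le one_le_two) (Or.inl h)]
  simp_rw [mul_comm (φ _)]
  rw [integral_lapl_mul hψ (hφ.of_le one_le_two) (Or.inr h)]
  simp_rw [mul_comm]

theorem norm_sq_le_sum_sq_apply_single {n : ℕ} (A : Euc n →L[ℝ] ℝ) :
    ‖A‖ ^ 2 ≤ ∑ i, A (EuclideanSpace.single i 1) * A (EuclideanSpace.single i 1) := by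
  have h0 : 0 ≤ ∑ i, A (EuclideanSpace.single i 1) * A (EuclideanSpace.single i 1) :=
    Finset.sum_nonneg fun i _ => mul_self_nonneg _
  refine (Real.le_sqrt (norm_nonneg _) h0).1 ?_
  refine A.opNorm_le_bound (Real.sqrt_nonneg _) fun v => ?_
  have hv : v = ∑ i, v i • EuclideanSpace.single i (1 : ℝ) := by
    ext j; simp [Finset.sum_apply, Pi.single_apply]
  have : A v = ∑ i, A (EuclideanSpace.single i 1) * v i := by
    conv_lhs => rw [hv]
    simp [mul_comm]
  rw [this, Real.norm_eq_abs, EuclideanSpace.norm_eq, ← Real.sqrt_mul h0]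
  refine Real.abs_le_sqrt ?_
  simpa [sq_abs, ← sq] using Finset.sum_mul_sq_le_sq_mul_sq Finset.univ
    (fun i => A (EuclideanSpace.single i 1)) (fun i => v i)

/-- A `C¹` truncation between two levels. -/
theorem exists_truncation {s₁ s₂ r : ℝ} (hs : s₁ < s₂) (hr0 : 0 < r) (hr1 : r < 1) :
    ∃ T b : ℝ → ℝ, ∃ L, (∀ x, HasDerivAt T (b x) x) ∧ Continuous b ∧ (∀ x, 0 ≤ b x) ∧
      (∀ x, b x ≤ (Set.Ioo s₁ s₂).indicator 1 x) ∧ (∀ x ≤ s₁, T x = 0) ∧ (∀ x, s₂ ≤ x → T x = L) ∧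
      r * (s₂ - s₁) ≤ L ∧ (∀ x, 0 ≤ T x) ∧ ∀ x, T x ≤ L := by
  have hd : 0 < s₂ - s₁ := sub_pos.2 hs
  let β : ContDiffBump ((s₁ + s₂) / 2) :=
    { rIn := r * (s₂ - s₁) / 2
      rOut := (s₂ - s₁) / 2
      rIn_pos := by positivity
      rIn_lt_rOut := by nlinarith }
  have hβc : Continuous β := β.continuous
  have hi : ∀ x y, IntervalIntegrable β volume x y := fun x y => hβc.intervalIntegrable x y
  have hball : Metric.ball ((s₁ + s₂) / 2) ((s₂ - s₁) / 2) = Set.Ioo s₁ s₂ := by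
    rw [Real.ball_eq_Ioo]; congr 1 <;> ring
  have hz : ∀ x, x ∉ Set.Ioo s₁ s₂ → β x = 0 := fun x hx => by
    rw [← hball] at hx
    exact Function.notMem_support.1 (by rwa [β.support_eq])
  have hT1 : ∀ x ≤ s₁, ∫ y in s₁..x, β y = 0 := fun x hx =>
    intervalIntegral.integral_zero_ae (ae_of_all _ fun y hy => hz y fun h => by
      rw [Set.uIoc_of_ge hx] at hy; exact absurd h.1 (not_lt.2 hy.2))
  have hT2 : ∀ x, s₂ ≤ x → ∫ y in s₁..x, β y = ∫ y in s₁..s₂, β y := fun x hx => by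
    rw [← intervalIntegral.integral_add_adjacent_intervals (hi s₁ s₂) (hi s₂ x),
      intervalIntegral.integral_zero_ae (a := s₂) (b := x), add_zero]
    refine ae_of_all _ fun y hy => hz y fun h => ?_
    rw [Set.uIoc_of_le hx] at hy; exact absurd h.2 (not_lt.2 hy.1.le)
  have hmono : Monotone fun x => ∫ y in s₁..x, β y := fun x y hxy => by
    have := intervalIntegral.integral_nonneg (μ := volume) hxy fun z _ => β.nonneg' z
    simp only
    rw [← intervalIntegral.integral_add_adjacent_intervals (hi s₁ x) (hi x y)]
    linarith
  have h0 : ∀ x, 0 ≤ ∫ y in s₁..x, β y := fun x => by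
    rcases le_total x s₁ with h | h
    · exact (hT1 x h).ge
    · simpa using hmono h
  refine ⟨fun x => ∫ y in s₁..x, β y, β, ∫ y in s₁..s₂, β y, fun x =>
    intervalIntegral.integral_hasDerivAt_right (hi _ _)
      hβc.stronglyMeasurable.stronglyMeasurableAtFilter hβc.continuousAt,
    hβc, fun x => β.nonneg, fun x => ?_, hT1, hT2, ?_, h0, fun x => ?_⟩
  · by_cases hx : x ∈ Set.Ioo s₁ s₂
    · rw [Set.indicator_of_mem hx]; exact β.le_one
    · rw [hz x hx]; exact Set.indicator_nonneg (fun _ _ => zero_le_one) x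
  · set p := (s₁ + s₂) / 2 - r * (s₂ - s₁) / 2 with hp
    set q := (s₁ + s₂) / 2 + r * (s₂ - s₁) / 2 with hq
    have hpq : p ≤ q := by rw [hp, hq]; nlinarith
    have h1 : ∫ y in p..q, β y = r * (s₂ - s₁) := by
      rw [intervalIntegral.integral_congr (g := fun _ => (1 : ℝ))]
      · simp [hp, hq]
      · intro y hy
        rw [Set.uIcc_of_le hpq] at hy
        refine β.one_of_mem_closedBall ?_
        rw [Real.closedBall_eq_Icc]; exact hy
    rw [← intervalIntegral.integral_add_adjacent_intervals (hi s₁ p) (hi p s₂),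
      ← intervalIntegral.integral_add_adjacent_intervals (hi p q) (hi q s₂), h1]
    have h2 := h0 p
    have h3 : 0 ≤ ∫ y in q..s₂, β y := intervalIntegral.integral_nonneg
      (by rw [hq]; nlinarith) fun z _ => β.nonneg' z
    linarith
  · rcases le_total x s₂ with h | h
    · exact hmono h
    · exact (hT2 x h).le

/-- A Cauchy–Schwarz inequality with weight `w`, in the form used for level sets. -/
theorem sq_mul_le_of_integral_le {α : Type*} [MeasurableSpace α] {μ : Measure α} {w y : α → ℝ}
    (hw : ∀ x, 0 ≤ w x) (i1 : Integrable (fun x => w x * y x) μ)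
    (i2 : Integrable (fun x => w x * y x ^ 2) μ) (i3 : Integrable w μ) {c L M m : ℝ}
    (hc : 0 < c) (hM : 0 < M) (h1 : c * L ≤ ∫ x, w x * y x ∂μ)
    (h2 : ∫ x, w x * y x ^ 2 ∂μ ≤ M * L) (h3 : ∫ x, w x ∂μ ≤ m) : c ^ 2 * L ≤ M * m := by
  have h4 : ∫ x, w x * y x ∂μ ≤
      c / (2 * M) * (∫ x, w x * y x ^ 2 ∂μ) + (∫ x, w x ∂μ) * (M / (2 * c)) := by
    rw [← integral_const_mul, ← integral_mul_const,
      ← integral_add (i2.const_mul _) (i3.mul_const _)]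
    refine integral_mono i1 ((i2.const_mul _).add (i3.mul_const _)) fun x => ?_
    have e : c / (2 * M) * (w x * y x ^ 2) + w x * (M / (2 * c)) - w x * y x =
        w x * ((c * y x - M) ^ 2 / (2 * c * M)) := by
      field_simp
      ring
    have : 0 ≤ w x * ((c * y x - M) ^ 2 / (2 * c * M)) := mul_nonneg (hw x) (by positivity)
    linarith
  have h5 : c / (2 * M) * (∫ x, w x * y x ^ 2 ∂μ) ≤ c / (2 * M) * (M * L) :=
    mul_le_mul_of_nonneg_left h2 (by positivity)
  have h6 : (∫ x, w x ∂μ) * (M / (2 * c)) ≤ m * (M / (2 * c)) :=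
    mul_le_mul_of_nonneg_right h3 (by positivity)
  have e1 : c / (2 * M) * (M * L) = c * L / 2 := by field_simp
  have e2 : m * (M / (2 * c)) = M * m / (2 * c) := by ring
  have : c * L / 2 ≤ M * m / (2 * c) := by linarith
  rw [le_div_iff₀ (by positivity)] at this
  linarith

/-- The energy of a compactly supported function between two levels. -/
theorem integral_mul_norm_fderiv_sq_le {n : ℕ} {φ : Euc n → ℝ} (hφ : ContDiff ℝ 2 φ)
    (hφc : HasCompactSupport φ) {T b : ℝ → ℝ} {L M : ℝ} (hT : ∀ x, HasDerivAt T (b x) x)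
    (hb : Continuous b) (hb0 : ∀ x, 0 ≤ b x) (hbz : b 0 = 0) (hT0 : ∀ x, 0 ≤ T x)
    (hTL : ∀ x, T x ≤ L) (hMφ : ∫ x, |lapl n φ x| ≤ 2 * M) :
    ∫ x, b (φ x) * ‖fderiv ℝ φ x‖ ^ 2 ≤ M * L := by
  have hL : 0 ≤ L := (hT0 0).trans (hTL 0)
  have hTc : ContDiff ℝ 1 T := by
    rw [contDiff_one_iff_deriv]
    refine ⟨fun x => (hT x).differentiableAt, ?_⟩
    rwa [funext fun x => (hT x).deriv]
  set f : Euc n → ℝ := fun x => T (φ x) with hf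
  have hfc : ContDiff ℝ 1 f := hTc.comp (hφ.of_le one_le_two)
  have hfd : ∀ x, fderiv ℝ f x = b (φ x) • fderiv ℝ φ x := fun x =>
    ((hT (φ x)).comp_hasFDerivAt x
      (hφ.differentiable two_ne_zero x).hasFDerivAt).fderiv
  have hdc : Continuous (fderiv ℝ φ) := hφ.continuous_fderiv two_ne_zero
  have hds : HasCompactSupport (fderiv ℝ φ) := hφc.fderiv (𝕜 := ℝ)
  have hbc : Continuous fun x => b (φ x) := hb.comp hφ.continuous
  have hbs : HasCompactSupport fun x => b (φ x) := hφc.comp_left hbz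
  have i2 : Integrable fun x => b (φ x) * ‖fderiv ℝ φ x‖ ^ 2 :=
    (hbc.mul (hdc.norm.pow 2)).integrable_of_hasCompactSupport hbs.mul_right
  have hlc := continuous_lapl hφ
  have hls := hasCompactSupport_lapl hφc
  have e := integral_lapl_mul hφ hfc (Or.inl hφc)
  have h1 : ∫ x, b (φ x) * ‖fderiv ℝ φ x‖ ^ 2 ≤ ∫ x, ∑ i, fderiv ℝ φ x
      (EuclideanSpace.single i 1) * fderiv ℝ f x (EuclideanSpace.single i 1) := by
    refine integral_mono i2 (Continuous.integrable_of_hasCompactSupport ?_ ?_) fun x => ?_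
    · exact continuous_finsetSum _ fun i _ => (hdc.clm_apply continuous_const).mul
        ((hfc.continuous_fderiv one_ne_zero).clm_apply continuous_const)
    · refine hds.mono fun x hx => ?_
      contrapose! hx
      simp only [Function.mem_support, not_not] at hx ⊢
      simp [hx]
    · simp only [hfd]
      calc b (φ x) * ‖fderiv ℝ φ x‖ ^ 2 ≤ b (φ x) * _ :=
            mul_le_mul_of_nonneg_left (norm_sq_le_sum_sq_apply_single _) (hb0 _)
        _ = _ := by
            rw [Finset.mul_sum]
            refine Finset.sum_congr rfl fun i _ => ?_
            rw [_root_.smul_apply, smul_eq_mul]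
            ring
  have h2 : ∫ x, lapl n φ x * (L / 2 - f x) ≤ ∫ x, |lapl n φ x| * (L / 2) := by
    refine integral_mono
      ((hlc.mul (continuous_const.sub hfc.continuous)).integrable_of_hasCompactSupport
        hls.mul_right)
      ((hlc.abs.mul_const _).integrable_of_hasCompactSupport
        (HasCompactSupport.mul_right (hls.comp_left abs_zero))) fun x => ?_
    refine (le_abs_self _).trans ?_
    rw [abs_mul]
    refine mul_le_mul_of_nonneg_left ?_ (abs_nonneg _)
    rw [abs_le]
    constructor <;> linarith [hT0 (φ x), hTL (φ x)]
  have h3 : ∫ x, lapl n φ x * (L / 2 - f x) = - ∫ x, lapl n φ x * f x := by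
    simp_rw [mul_sub]
    rw [integral_sub, integral_mul_const, integral_lapl_eq_zero hφ hφc, zero_mul, zero_sub]
    · exact (hlc.mul_const _).integrable_of_hasCompactSupport hls.mul_right
    · exact (hlc.mul hfc.continuous).integrable_of_hasCompactSupport hls.mul_right
  rw [integral_mul_const] at h2
  have h4 : (∫ x, |lapl n φ x|) * (L / 2) ≤ 2 * M * (L / 2) :=
    mul_le_mul_of_nonneg_right hMφ (by positivity)
  linarith

theorem sq_mul_sub_le_of_level {n : ℕ} (hn : n ≠ 0) {φ : Euc n → ℝ} (hφ : ContDiff ℝ 2 φ)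
    (hφc : HasCompactSupport φ) {s₁ s₂ a k M : ℝ} (hs1 : 0 ≤ s₁) (hs : s₁ < s₂) (ha : 0 < a)
    (hk : 0 < k) (hM : 0 < M) (hMφ : ∫ x, |lapl n φ x| ≤ 2 * M)
    (hφa : ENNReal.ofReal (a ^ n) ≤ volume {x | s₂ < φ x})
    (hkn : volume (Metric.ball (0 : Euc n) 1) = ENNReal.ofReal (k ^ n)) :
    (n * k * a ^ (n - 1)) ^ 2 * (s₂ - s₁) ≤ M * volume.real {x | s₁ < φ x ∧ φ x ≤ s₂} := by
  set m := volume.real {x | s₁ < φ x ∧ φ x ≤ s₂} with hm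
  have hc0 : 0 < n * k * a ^ (n - 1) := by positivity
  have hfin : volume {x | s₁ < φ x ∧ φ x ≤ s₂} ≠ ⊤ := by
    refine ne_top_of_le_ne_top hφc.isCompact.measure_lt_top.ne (measure_mono ?_)
    exact fun x hx => subset_tsupport φ (ne_of_gt (hs1.trans_lt hx.1))
  have key : ∀ r : ℝ, 0 < r → r < 1 →
      (n * k * a ^ (n - 1)) ^ 2 * (r * (s₂ - s₁)) ≤ M * m := by
    intro r hr0 hr1
    obtain ⟨T, b, L, hT, hb, hb0, hb1, hT1, hT2, hL, hT0, hTL⟩ := exists_truncation hs hr0 hr1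
    have hL0 : 0 < L := (mul_pos hr0 (sub_pos.2 hs)).trans_le hL
    have hbz : b 0 = 0 := by
      have := hb1 0
      rw [Set.indicator_of_notMem (fun h => not_lt.2 hs1 h.1)] at this
      exact le_antisymm this (hb0 0)
    have hdc : Continuous (fderiv ℝ φ) := hφ.continuous_fderiv two_ne_zero
    have hbc : Continuous fun x => b (φ x) := hb.comp hφ.continuous
    have hbs : HasCompactSupport fun x => b (φ x) := hφc.comp_left hbz
    have i1 : Integrable fun x => b (φ x) * ‖fderiv ℝ φ x‖ :=
      (hbc.mul hdc.norm).integrable_of_hasCompactSupport hbs.mul_right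
    have i2 : Integrable fun x => b (φ x) * ‖fderiv ℝ φ x‖ ^ 2 :=
      (hbc.mul (hdc.norm.pow 2)).integrable_of_hasCompactSupport hbs.mul_right
    have i3 : Integrable fun x => b (φ x) := hbc.integrable_of_hasCompactSupport hbs
    have h1 : n * k * a ^ (n - 1) * L ≤ ∫ x, b (φ x) * ‖fderiv ℝ φ x‖ := by
      have hTc : ContDiff ℝ 1 T := by
        rw [contDiff_one_iff_deriv]
        refine ⟨fun x => (hT x).differentiableAt, ?_⟩
        rwa [funext fun x => (hT x).deriv]
      have hfd : ∀ x, ‖fderiv ℝ (fun x => T (φ x)) x‖ = b (φ x) * ‖fderiv ℝ φ x‖ := fun x => by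
        have : fderiv ℝ (fun x => T (φ x)) x = b (φ x) • fderiv ℝ φ x :=
          ((hT (φ x)).comp_hasFDerivAt x (hφ.differentiable two_ne_zero x).hasFDerivAt).fderiv
        rw [this, norm_smul, Real.norm_of_nonneg (hb0 _)]
      have := mul_le_integral_norm_fderiv hn (hTc.comp (hφ.of_le one_le_two))
        (hφc.comp_left (hT1 0 hs1)) (fun x => hT0 _) ha hk hL0.le
        (hφa.trans (measure_mono fun x (hx : s₂ < φ x) => (hT2 _ hx.le).ge)) hkn
      exact this.trans_eq (integral_congr_ae (ae_of_all _ hfd))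
    have h3 : ∫ x, b (φ x) ≤ m := by
      have hms : MeasurableSet {x | s₁ < φ x ∧ φ x ≤ s₂} :=
        (measurableSet_lt measurable_const hφ.continuous.measurable).inter
          (measurableSet_le hφ.continuous.measurable measurable_const)
      rw [hm, ← integral_indicator_one hms]
      refine integral_mono i3 ((integrable_indicator_iff hms).2 (integrableOn_const hfin))
        fun x => (hb1 _).trans ?_
      by_cases hx : φ x ∈ Set.Ioo s₁ s₂
      · rw [Set.indicator_of_mem hx, Set.indicator_of_mem (by exact ⟨hx.1, hx.2.le⟩)]
        rfl
      · rw [Set.indicator_of_notMem hx]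
        exact Set.indicator_nonneg (fun _ _ => zero_le_one) x
    exact (mul_le_mul_of_nonneg_left hL (by positivity)).trans
      (sq_mul_le_of_integral_le (fun x => hb0 _) i1 i2 i3 hc0 hM h1
        (integral_mul_norm_fderiv_sq_le hφ hφc hT hb hb0 hbz hT0 hTL hMφ) h3)
  refine le_of_tendsto (x := 𝓝[<] (1 : ℝ))
    (f := fun r => (n * k * a ^ (n - 1)) ^ 2 * (r * (s₂ - s₁))) ?_ ?_
  · refine tendsto_nhdsWithin_of_tendsto_nhds ?_
    have : Continuous fun r : ℝ => (n * k * a ^ (n - 1)) ^ 2 * (r * (s₂ - s₁)) := by fun_prop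
    simpa using this.tendsto 1
  · filter_upwards [Ioo_mem_nhdsLT (zero_lt_one' ℝ)] with r hr using key r hr.1 hr.2

theorem mul_le_rpow_neg_sub_rpow_neg {β δ x y V : ℝ} (hβ : 0 < β) (hδ : 0 ≤ δ) (hx : 0 < x)
    (hxV : x ≤ V) (hy : x + δ * x ^ (β + 1) ≤ y) :
    β * δ * (1 + δ * V ^ β) ^ (-(β + 1)) ≤ x ^ (-β) - y ^ (-β) := by
  set z := δ * x ^ β with hz
  have hxβ : 0 < x ^ β := Real.rpow_pos_of_pos hx _
  have hz0 : 0 ≤ z := by positivity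
  have hw : 0 < 1 + z := by positivity
  have h1 : y ^ (-β) ≤ x ^ (-β) * (1 + z) ^ (-β) := by
    rw [← Real.mul_rpow hx.le hw.le]
    refine Real.rpow_le_rpow_of_nonpos (by positivity) ?_ (by linarith)
    rw [Real.rpow_add_one hx.ne'] at hy
    calc x * (1 + z) = x + δ * (x ^ β * x) := by rw [hz]; ring
      _ ≤ y := hy
  have h2 : (1 + δ * V ^ β) ^ (-(β + 1)) ≤ (1 + z) ^ (-(β + 1)) :=
    Real.rpow_le_rpow_of_nonpos hw (by rw [hz]; gcongr) (by linarith)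
  have h3 : β * z * (1 + z) ^ (-(β + 1)) ≤ 1 - (1 + z) ^ (-β) := by
    have e : 1 + β * (1 - (1 + z)⁻¹) ≤ (1 + z) ^ β := by
      rw [Real.rpow_def_of_pos hw]
      have := Real.add_one_le_exp (Real.log (1 + z) * β)
      have := mul_le_mul_of_nonneg_left (Real.one_sub_inv_le_log_of_pos hw) hβ.le
      linarith
    have hp : 0 < (1 + z) ^ (-β) := Real.rpow_pos_of_pos hw _
    have e2 := mul_le_mul_of_nonneg_right e hp.le
    rw [← Real.rpow_add hw, add_neg_cancel, Real.rpow_zero] at e2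
    have e3 : (1 + z) ^ (-(β + 1)) = (1 + z) ^ (-β) * (1 + z)⁻¹ := by
      rw [neg_add, Real.rpow_add hw, Real.rpow_neg_one]
    have e4 : β * z * (1 + z) ^ (-(β + 1)) = β * (1 - (1 + z)⁻¹) * (1 + z) ^ (-β) := by
      rw [e3]
      field_simp
      ring
    linarith
  have hxn : 0 < x ^ (-β) := Real.rpow_pos_of_pos hx _
  have e5 : x ^ (-β) * z = δ := by
    rw [hz, mul_left_comm, ← Real.rpow_add hx, neg_add_cancel, Real.rpow_zero, mul_one]
  calc β * δ * (1 + δ * V ^ β) ^ (-(β + 1)) ≤ β * δ * (1 + z) ^ (-(β + 1)) := by gcongr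
    _ = x ^ (-β) * (β * z * (1 + z) ^ (-(β + 1))) := by rw [← e5]; ring
    _ ≤ x ^ (-β) * (1 - (1 + z) ^ (-β)) := by gcongr
    _ ≤ _ := by linarith

/-- An integrated form of a differential inequality for a decreasing function. -/
theorem mul_le_rpow_neg_sub_rpow_neg_of_forall {β c S V : ℝ} (hβ : 0 < β) (hc : 0 < c)
    (hS : 0 < S) {μ : ℝ → ℝ} (hμ0 : ∀ s, 0 ≤ s → s ≤ S → 0 < μ s)
    (hμV : ∀ s, 0 ≤ s → s ≤ S → μ s ≤ V)
    (h : ∀ s₁ s₂, 0 ≤ s₁ → s₁ < s₂ → s₂ ≤ S → c * (s₂ - s₁) * μ s₂ ^ (β + 1) ≤ μ s₁ - μ s₂) :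
    β * (c * S) ≤ μ S ^ (-β) - μ 0 ^ (-β) := by
  have key : ∀ N : ℕ, β * (c * S) * (1 + c * S * V ^ β * (1 / ((N : ℝ) + 1))) ^ (-(β + 1)) ≤
      μ S ^ (-β) - μ 0 ^ (-β) := by
    intro N
    have hN : (0 : ℝ) < N + 1 := by positivity
    have hs := Finset.sum_range_sub (fun i : ℕ => μ (i * (S / (N + 1))) ^ (-β)) (N + 1)
    have e1 : ((N + 1 : ℕ) : ℝ) * (S / (N + 1)) = S := by push_cast; field_simp
    rw [e1, Nat.cast_zero, zero_mul] at hs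
    rw [← hs]
    have h2 : ∀ i ∈ Finset.range (N + 1), β * (c * (S / (N + 1))) *
        (1 + (c * (S / (N + 1))) * V ^ β) ^ (-(β + 1)) ≤
        μ ((i + 1 : ℕ) * (S / (N + 1))) ^ (-β) - μ (i * (S / (N + 1))) ^ (-β) := by
      intro i hi
      have hle : ((i + 1 : ℕ) : ℝ) * (S / (N + 1)) ≤ S := by
        rw [mul_div_assoc', div_le_iff₀ hN, mul_comm]
        have : ((i + 1 : ℕ) : ℝ) ≤ N + 1 := by exact_mod_cast Finset.mem_range.1 hi
        gcongr
      have hp : (0 : ℝ) ≤ (i + 1 : ℕ) * (S / (N + 1)) := by positivity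
      refine mul_le_rpow_neg_sub_rpow_neg hβ (by positivity) (hμ0 _ hp hle) (hμV _ hp hle) ?_
      have hd : 0 < S / (N + 1) := by positivity
      have := h (i * (S / (N + 1))) ((i + 1 : ℕ) * (S / (N + 1))) (by positivity)
        (by push_cast; nlinarith) hle
      have e : ((i + 1 : ℕ) * (S / (N + 1)) - i * (S / (N + 1)) : ℝ) = S / (N + 1) := by
        push_cast; ring
      rw [e] at this
      linarith
    have h3 := Finset.sum_le_sum h2
    refine le_trans (le_of_eq ?_) h3
    rw [Finset.sum_const, Finset.card_range, nsmul_eq_mul]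
    have e2 : c * (S / (N + 1)) * V ^ β = c * S * V ^ β * (1 / ((N : ℝ) + 1)) := by ring
    rw [e2]
    push_cast
    field_simp
  refine le_of_tendsto' (x := atTop) ?_ key
  have h1 : Tendsto (fun N : ℕ => 1 + c * S * V ^ β * (1 / ((N : ℝ) + 1))) atTop (𝓝 1) := by
    simpa using (tendsto_one_div_add_atTop_nhds_zero_nat.const_mul (c * S * V ^ β)).const_add 1
  simpa using (h1.rpow_const (p := -(β + 1)) (Or.inl one_ne_zero)).const_mul (β * (c * S))

theorem omegaS_pos {n : ℕ} (hn : n ≠ 0) : 0 < omegaS n := by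
  unfold omegaS
  have : 0 < Real.Gamma ((n : ℝ) / 2) := Real.Gamma_pos_of_pos (by positivity)
  positivity

theorem volume_ball_zero_one {n : ℕ} (hn : n ≠ 0) :
    volume (Metric.ball (0 : Euc n) 1) = ENNReal.ofReal (omegaS n / n) := by
  have : Nonempty (Fin n) := ⟨⟨0, Nat.pos_of_ne_zero hn⟩⟩
  rw [EuclideanSpace.volume_ball]
  simp only [Fintype.card_fin, ENNReal.ofReal_one, one_pow, one_mul]
  congr 1
  have h0 : (n : ℝ) / 2 ≠ 0 := by positivity
  rw [Real.Gamma_add_one h0, omegaS, Real.sqrt_eq_rpow, ← Real.rpow_natCast, ← Real.rpow_mul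
    Real.pi_pos.le]
  have : 0 < Real.Gamma ((n : ℝ) / 2) := Real.Gamma_pos_of_pos (by positivity)
  rw [show (1 / 2 * (n : ℝ)) = n / 2 by ring]
  field_simp

theorem NstarV_eq {n : ℕ} (hn : 3 ≤ n) (V t : ℝ) :
    NstarV n V t = (t ^ (-(((n : ℝ) - 2) / n)) - V ^ (-(((n : ℝ) - 2) / n))) /
      (n * ((n : ℝ) - 2) * (omegaS n / n) ^ (2 / (n : ℝ))) := by
  have hn0 : n ≠ 0 := by lia
  have hn' : (0 : ℝ) < n := by positivity
  have hn2 : (0 : ℝ) < (n : ℝ) - 2 := by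
    have : (3 : ℝ) ≤ n := by exact_mod_cast hn
    linarith
  have hω := omegaS_pos hn0
  have hκ : 0 < omegaS n / n := by positivity
  rw [NstarV, if_neg (by lia), cConst]
  have e : ((n : ℝ) - 2) / n = 1 - 2 / n := by field_simp
  have e1 : (omegaS n / n) ^ (((n : ℝ) - 2) / n) =
      (omegaS n / n) / (omegaS n / n) ^ (2 / (n : ℝ)) := by
    rw [e, Real.rpow_sub hκ, Real.rpow_one]
  rw [e1]
  have : 0 < (omegaS n / n) ^ (2 / (n : ℝ)) := Real.rpow_pos_of_pos hκ _
  field_simp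

/-- The level estimate for `C²` functions with compact support. -/
theorem le_mul_NstarV_of_level {n : ℕ} (hn : 3 ≤ n) {Ω : Set (Euc n)} (hΩ : volume Ω ≠ ⊤)
    {φ : Euc n → ℝ} (hφ : ContDiff ℝ 2 φ) (hφc : HasCompactSupport φ) (hφΩ : tsupport φ ⊆ Ω)
    {M S t : ℝ} (hM : 0 < M) (hMφ : ∫ x, |lapl n φ x| ≤ 2 * M) (hS : 0 < S) (ht : 0 < t)
    (hSt : ENNReal.ofReal t ≤ volume {x | S < φ x}) :
    S ≤ M * NstarV n (volume Ω).toReal t := by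
  have hn0 : n ≠ 0 := by lia
  have hn' : (0 : ℝ) < n := by positivity
  have hn2 : (0 : ℝ) < (n : ℝ) - 2 := by
    have : (3 : ℝ) ≤ n := by exact_mod_cast hn
    linarith
  have hω := omegaS_pos hn0
  have hκ : 0 < omegaS n / n := by positivity
  set V := (volume Ω).toReal with hV
  set k := (omegaS n / n) ^ (1 / (n : ℝ)) with hk
  have hk0 : 0 < k := Real.rpow_pos_of_pos hκ _
  have hroot : ∀ x : ℝ, 0 ≤ x → (x ^ (1 / (n : ℝ))) ^ n = x := fun x hx => by
    rw [← Real.rpow_natCast, ← Real.rpow_mul hx, one_div_mul_cancel hn'.ne', Real.rpow_one]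
  have hkn : volume (Metric.ball (0 : Euc n) 1) = ENNReal.ofReal (k ^ n) := by
    rw [volume_ball_zero_one hn0, hk, hroot _ hκ.le]
  set μ : ℝ → ℝ := fun s => volume.real {x | s < φ x} with hμ
  have hsub : ∀ s, 0 ≤ s → {x | s < φ x} ⊆ Ω := fun s hs x hx =>
    hφΩ (subset_tsupport φ (ne_of_gt (hs.trans_lt hx)))
  have hfin : ∀ s, 0 ≤ s → volume {x | s < φ x} ≠ ⊤ := fun s hs =>
    ne_top_of_le_ne_top hΩ (measure_mono (hsub s hs))
  have hμt : ∀ s, 0 ≤ s → s ≤ S → t ≤ μ s := fun s hs hsS => by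
    rw [hμ, ← ENNReal.ofReal_le_ofReal_iff measureReal_nonneg, ofReal_measureReal (hfin s hs)]
    exact hSt.trans (measure_mono fun x hx => hsS.trans_lt hx)
  have hμV : ∀ s, 0 ≤ s → s ≤ S → μ s ≤ V := fun s hs _ =>
    ENNReal.toReal_mono hΩ (measure_mono (hsub s hs))
  set β := ((n : ℝ) - 2) / n with hβ
  have hβ0 : 0 < β := by positivity
  have main := mul_le_rpow_neg_sub_rpow_neg_of_forall (β := β) (c := (n * k) ^ 2 / M) (S := S)
    (V := V) (μ := μ) hβ0 (by positivity) hS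
    (fun s hs hsS => ht.trans_le (hμt s hs hsS)) hμV ?_
  · have h1 : μ S ^ (-β) ≤ t ^ (-β) :=
      Real.rpow_le_rpow_of_nonpos ht (hμt S hS.le le_rfl) (by linarith)
    have h2 : V ^ (-β) ≤ μ 0 ^ (-β) :=
      Real.rpow_le_rpow_of_nonpos (ht.trans_le (hμt 0 le_rfl hS.le)) (hμV 0 le_rfl hS.le)
        (by linarith)
    have h3 : β * ((n * k) ^ 2 / M * S) ≤ t ^ (-β) - V ^ (-β) := by linarith
    have hk2 : (omegaS n / n) ^ (2 / (n : ℝ)) = k ^ 2 := by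
      rw [hk, ← Real.rpow_natCast _ 2, ← Real.rpow_mul hκ.le]
      congr 1
      push_cast
      ring
    rw [NstarV_eq hn, hk2, mul_div_assoc', le_div_iff₀ (by positivity)]
    have e : β * ((n * k) ^ 2 / M * S) = S * (n * (n - 2) * k ^ 2) / M := by
      rw [hβ]; field_simp
    rw [e, div_le_iff₀ hM] at h3
    linarith
  · intro s₁ s₂ hs1 hs hs2
    have h0 : 0 < μ s₂ := ht.trans_le (hμt s₂ (hs1.trans hs.le) hs2)
    have h1 := sq_mul_sub_le_of_level hn0 hφ hφc hs1 hs
      (Real.rpow_pos_of_pos h0 (1 / (n : ℝ))) hk0 hM hMφ (by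
        rw [hroot _ h0.le, hμ, ofReal_measureReal (hfin _ (hs1.trans hs.le))]) hkn
    have h2 : volume.real {x | s₁ < φ x ∧ φ x ≤ s₂} = μ s₁ - μ s₂ := by
      have : {x | s₁ < φ x ∧ φ x ≤ s₂} = {x | s₁ < φ x} \ {x | s₂ < φ x} := by
        ext x; simp
      rw [this, measureReal_sdiff (show {x | s₂ < φ x} ⊆ {x | s₁ < φ x} from fun x hx => hs.trans hx)
        (measurableSet_lt measurable_const hφ.continuous.measurable) (hfin _ hs1)]
    have h3 : ((μ s₂ ^ (1 / (n : ℝ))) ^ (n - 1)) ^ 2 = μ s₂ ^ (β + 1) := by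
      rw [← pow_mul, ← Real.rpow_natCast, ← Real.rpow_mul h0.le]
      congr 1
      rw [hβ]
      push_cast [Nat.cast_sub (show 1 ≤ n by lia)]
      field_simp
      ring
    rw [h2, mul_pow, h3] at h1
    have e : (n * k) ^ 2 / M * (s₂ - s₁) * μ s₂ ^ (β + 1) =
      ((n * k) ^ 2 * μ s₂ ^ (β + 1) * (s₂ - s₁)) / M := by ring
    rw [e, div_le_iff₀ hM]
    linarith

theorem NstarV_nonneg {n : ℕ} (hn : 3 ≤ n) {V t : ℝ} (ht : 0 < t) (htV : t ≤ V) :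
    0 ≤ NstarV n V t := by
  have hω := omegaS_pos (n := n) (by lia)
  have hn2 : (0 : ℝ) < (n : ℝ) - 2 := by
    have : (3 : ℝ) ≤ n := by exact_mod_cast hn
    linarith
  rw [NstarV_eq hn]
  have : V ^ (-(((n : ℝ) - 2) / n)) ≤ t ^ (-(((n : ℝ) - 2) / n)) :=
    Real.rpow_le_rpow_of_nonpos ht htV (neg_nonpos.2 (by positivity))
  exact div_nonneg (sub_nonneg.2 this) (by positivity)

theorem decRearr_le_of_forall_lt {n : ℕ} {Ω : Set (Euc n)} {u : Euc n → ℝ} {t s₀ : ℝ}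
    (hs₀ : 0 ≤ s₀)
    (h : ∀ s, s₀ < s → volume {x ∈ Ω | s < |u x|} ≤ ENNReal.ofReal t) :
    decRearr n Ω u t ≤ s₀ :=
  le_of_forall_gt_imp_ge_of_dense fun s hs =>
    csInf_le ⟨0, fun _ hx => hx.1⟩ ⟨hs₀.trans hs.le, h s hs⟩

theorem IsTestFun.contDiff_two {n : ℕ} {Ω : Set (Euc n)} {φ : Euc n → ℝ}
    (h : IsTestFun n Ω φ) : ContDiff ℝ 2 φ :=
  contDiff_infty.1 h.1 2

theorem lapl_eq_zero_of_notMem_tsupport {n : ℕ} {φ : Euc n → ℝ} {x : Euc n}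
    (hx : x ∉ tsupport φ) : lapl n φ x = 0 := by
  have : iteratedFDeriv ℝ 2 φ x = 0 := by
    by_contra h
    exact hx (tsupport_iteratedFDeriv_subset (𝕜 := ℝ) 2 (subset_tsupport _ h))
  simp [lapl, this]

theorem IsTestFun.integral_abs_lapl_le {n : ℕ} {Ω : Set (Euc n)} {φ f : Euc n → ℝ}
    (hφ : IsTestFun n Ω φ) (hf : IntegrableOn f Ω) :
    ∫ x, |lapl n φ x| ≤ (∫ x in Ω, |lapl n φ x - f x|) + L1norm n Ω f := by
  have hl : Integrable (lapl n φ) :=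
    (continuous_lapl hφ.contDiff_two).integrable_of_hasCompactSupport
      (hasCompactSupport_lapl hφ.2.1)
  have e : ∫ x, |lapl n φ x| = ∫ x in Ω, |lapl n φ x| :=
    (setIntegral_eq_integral_of_forall_compl_eq_zero fun x hx => by
      rw [lapl_eq_zero_of_notMem_tsupport fun h => hx (hφ.2.2 h), abs_zero]).symm
  have hi : IntegrableOn (fun x => |lapl n φ x - f x|) Ω := (hl.integrableOn.sub hf).abs
  rw [e, L1norm, ← integral_add hi hf.abs]
  refine integral_mono hl.integrableOn.abs (hi.add hf.abs) fun x => ?_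
  have := abs_add_le (lapl n φ x - f x) (f x)
  rwa [sub_add_cancel] at this

theorem decRearr_le_of_nonneg {n : ℕ} (hn : 3 ≤ n) {Ω : Set (Euc n)} (hΩo : IsOpen Ω)
    (hΩb : Bornology.IsBounded Ω) {u f : Euc n → ℝ} (hu : MemW21Delta0 n Ω u f)
    (h0 : ∀ᵐ x ∂(volume.restrict Ω), 0 ≤ u x) {t : ℝ} (ht : 0 < t)
    (ht' : t ≤ (volume Ω).toReal) :
    decRearr n Ω u t ≤ (1 / 2) * NstarV n (volume Ω).toReal t * L1norm n Ω f := by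
  obtain ⟨hui, hfi, φ, hφ, hφu, hφf⟩ := hu
  have hN := NstarV_nonneg hn ht ht'
  have hf0 : 0 ≤ L1norm n Ω f := integral_nonneg fun x => abs_nonneg _
  have hΩm := hΩo.measurableSet
  have hΩfin : volume Ω ≠ ⊤ := hΩb.measure_lt_top.ne
  have hint : ∀ k, IntegrableOn (φ k) Ω := fun k =>
    ((hφ k).1.continuous.integrable_of_hasCompactSupport (hφ k).2.1).integrableOn
  refine decRearr_le_of_forall_lt (by positivity) fun s hs => ?_
  obtain ⟨s', hs', hs's⟩ := exists_between hs
  have hs'0 : 0 < s' := lt_of_le_of_lt (by positivity) hs'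
  by_contra! hlt
  have hd : 0 < s - s' := sub_pos.2 hs's
  have hm : ∀ k, volume {x ∈ Ω | s < |u x|} ≤ volume {x | s' < φ k x} +
      ENNReal.ofReal ((∫ x in Ω, |φ k x - u x|) / (s - s')) := by
    intro k
    have h1 : volume {x ∈ Ω | s < |u x|} = volume.restrict Ω {x | s < |u x|} := by
      rw [Measure.restrict_apply' hΩm, Set.inter_comm]; rfl
    have h2 : volume.restrict Ω {x | s < |u x|} ≤
        volume.restrict Ω ({x | s' < φ k x} ∪ {x | s - s' ≤ |φ k x - u x|}) := by
      refine measure_mono_ae ?_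
      filter_upwards [h0] with x hx hxs
      by_cases hc : s' < φ k x
      · exact Or.inl hc
      · refine Or.inr ?_
        have hxs' : s < |u x| := hxs
        rw [abs_of_nonneg hx] at hxs'
        change s - s' ≤ |φ k x - u x|
        rw [abs_sub_comm]
        exact le_trans (by linarith) (le_abs_self _)
    have h3 := mul_meas_ge_le_integral_of_nonneg (μ := volume.restrict Ω)
      (f := fun x => |φ k x - u x|) (ae_of_all _ fun x => abs_nonneg _)
      ((hint k).sub hui).abs (s - s')
    have hfin : volume.restrict Ω {x | s - s' ≤ |φ k x - u x|} ≠ ⊤ :=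
      ne_top_of_le_ne_top (by simpa using hΩfin) (measure_mono (Set.subset_univ _))
    rw [h1]
    refine h2.trans ((measure_union_le _ _).trans (add_le_add (Measure.restrict_apply_le _ _) ?_))
    rw [← ofReal_measureReal hfin]
    refine ENNReal.ofReal_le_ofReal ?_
    rw [le_div_iff₀ hd, mul_comm]
    exact h3
  have hev : ∀ᶠ k in atTop, ENNReal.ofReal t ≤ volume {x | s' < φ k x} := by
    have hlim : Tendsto (fun k => ENNReal.ofReal t +
        ENNReal.ofReal ((∫ x in Ω, |φ k x - u x|) / (s - s'))) atTop (𝓝 (ENNReal.ofReal t)) := by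
      have := ENNReal.tendsto_ofReal (hφu.div_const (s - s'))
      rw [zero_div, ENNReal.ofReal_zero] at this
      simpa using tendsto_const_nhds.add this
    filter_upwards [hlim.eventually (gt_mem_nhds hlt)] with k hk
    by_contra! hc
    exact absurd hk (not_lt.2 ((hm k).trans (by gcongr)))
  have hfinal : ∀ᶠ k : ℕ in atTop, s' ≤ (((∫ x in Ω, |lapl n (φ k) x - f x|) + L1norm n Ω f) / 2
      + 1 / ((k : ℝ) + 1)) * NstarV n (volume Ω).toReal t := by
    filter_upwards [hev] with k hk
    have hJ : 0 ≤ ∫ x in Ω, |lapl n (φ k) x - f x| := integral_nonneg fun x => abs_nonneg _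
    have hk1 : 0 < 1 / ((k : ℝ) + 1) := Nat.one_div_pos_of_nat
    exact le_mul_NstarV_of_level hn hΩfin (hφ k).contDiff_two (hφ k).2.1 (hφ k).2.2
      (by positivity) (by linarith [(hφ k).integral_abs_lapl_le hfi]) hs'0 ht hk
  have hlim := (((hφf.add_const (L1norm n Ω f)).div_const 2).add
    tendsto_one_div_add_atTop_nhds_zero_nat).mul_const (NstarV n (volume Ω).toReal t)
  have := ge_of_tendsto hlim hfinal
  linarith

theorem contDiff_two_of_hasDerivAt {G p p' : ℝ → ℝ} (hG : ∀ τ, HasDerivAt G (p τ) τ)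
    (hp : ∀ τ, HasDerivAt p (p' τ) τ) (hp' : Continuous p') : ContDiff ℝ 2 G := by
  have e1 : deriv p = p' := funext fun τ => (hp τ).deriv
  have e2 : deriv G = p := funext fun τ => (hG τ).deriv
  have h1 : ContDiff ℝ 1 p :=
    contDiff_one_iff_deriv.2 ⟨fun τ => (hp τ).differentiableAt, e1 ▸ hp'⟩
  rw [show (2 : WithTop ℕ∞) = 1 + 1 by norm_num, contDiff_succ_iff_deriv]
  exact ⟨fun τ => (hG τ).differentiableAt, fun h => by simp at h, e2 ▸ h1⟩

theorem lapl_comp_norm_sq {n : ℕ} {G p p' : ℝ → ℝ} (hG : ∀ τ, HasDerivAt G (p τ) τ)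
    (hp : ∀ τ, HasDerivAt p (p' τ) τ) (hp' : Continuous p') (x : Euc n) :
    lapl n (fun y => G (‖y‖ ^ 2)) x = 4 * ‖x‖ ^ 2 * p' (‖x‖ ^ 2) + 2 * n * p (‖x‖ ^ 2) := by
  have hψ : ContDiff ℝ 2 fun y : Euc n => G (‖y‖ ^ 2) :=
    (contDiff_two_of_hasDerivAt hG hp hp').comp (contDiff_norm_sq ℝ)
  have hin : ∀ (y : Euc n) (i : Fin n), inner ℝ y (EuclideanSpace.single i (1 : ℝ)) = y i :=
    fun y i => by simp [EuclideanSpace.inner_single_right]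
  have h1 : ∀ (i : Fin n) (y : Euc n), fderiv ℝ (fun y : Euc n => G (‖y‖ ^ 2)) y
      (EuclideanSpace.single i 1) = p (‖y‖ ^ 2) * (2 * y i) := fun i y => by
    have h := (hG _).comp_hasFDerivAt y (hasStrictFDerivAt_norm_sq y).hasFDerivAt
    rw [show fderiv ℝ (fun y : Euc n => G (‖y‖ ^ 2)) y = _ from h.fderiv]
    simp [hin]
  rw [lapl_eq_sum_fderiv hψ]
  have h2 : ∀ i : Fin n, fderiv ℝ (fun y => fderiv ℝ (fun y : Euc n => G (‖y‖ ^ 2)) y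
      (EuclideanSpace.single i 1)) x (EuclideanSpace.single i 1) =
      4 * p' (‖x‖ ^ 2) * (x i) ^ 2 + 2 * p (‖x‖ ^ 2) := fun i => by
    rw [funext (h1 i)]
    have h3 : HasFDerivAt (fun y : Euc n => 2 * y i) ((2 : ℝ) • EuclideanSpace.proj (𝕜 := ℝ) i) x :=
      (EuclideanSpace.proj (𝕜 := ℝ) i).hasFDerivAt.const_mul 2
    have h4 := (hp (‖x‖ ^ 2)).comp_hasFDerivAt x (hasStrictFDerivAt_norm_sq x).hasFDerivAt
    have h5 := (h4.mul h3).fderiv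
    simp only [Function.comp_def] at h5
    erw [h5]
    simp [hin]
    ring
  simp_rw [h2]
  rw [Finset.sum_add_distrib, ← Finset.mul_sum, ← EuclideanSpace.real_norm_sq_eq, Finset.sum_const,
    Finset.card_univ, Fintype.card_fin, nsmul_eq_mul]
  ring

/-- A radial function whose Laplacian is a prescribed radial density, together with a bound for
its oscillation. -/
theorem exists_radial_potential {n : ℕ} (hn : 3 ≤ n) {r R : ℝ} (hr : 0 < r) (hrR : r < R)
    {ζ : ℝ → ℝ} (hζ : Continuous ζ) (hζ0 : ∀ y, 0 ≤ ζ y) (hζs : ∀ y, y ∉ Set.Ioo r R → ζ y = 0)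
    (hζ1 : ∫ y in r..R, ζ y = 1) :
    ∃ (ψ : Euc n → ℝ) (c : ℝ), ContDiff ℝ 2 ψ ∧
      (∀ x, lapl n ψ x = -2 * ζ ‖x‖ / ‖x‖ ^ (n - 1)) ∧
      ∀ x ∈ Metric.ball (0 : Euc n) R, |ψ x - c| ≤
        (r ^ (2 - (n : ℝ)) - R ^ (2 - (n : ℝ))) / ((n : ℝ) - 2) := by
  have hn2 : (0 : ℝ) < (n : ℝ) - 2 := by
    have : (3 : ℝ) ≤ n := by exact_mod_cast hn
    linarith
  have hR : 0 < R := hr.trans hrR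
  have hi : ∀ a b, IntervalIntegrable ζ volume a b := fun a b => hζ.intervalIntegrable a b
  set K : ℝ → ℝ := fun y => ∫ z in r..y, ζ z with hK
  have hKd : ∀ y, HasDerivAt K (ζ y) y := fun y =>
    intervalIntegral.integral_hasDerivAt_right (hi _ _)
      hζ.stronglyMeasurable.stronglyMeasurableAtFilter hζ.continuousAt
  have hKm : Monotone K := monotone_of_hasDerivAt_nonneg hKd hζ0
  have hK0 : ∀ y ≤ r, K y = 0 := fun y hy =>
    intervalIntegral.integral_zero_ae (ae_of_all _ fun z hz => hζs z fun h => by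
      rw [Set.uIoc_of_ge hy] at hz; exact absurd h.1 (not_lt.2 hz.2))
  have hKp : ∀ y, 0 ≤ K y := fun y => by
    rcases le_total y r with h | h
    · exact (hK0 y h).ge
    · exact (hK0 r le_rfl).ge.trans (hKm h)
  have hKR : ∀ y ≤ R, K y ≤ 1 := fun y hy => (hKm hy).trans_eq hζ1
  set p : ℝ → ℝ := fun τ => -K √τ / √τ ^ n with hp
  set p' : ℝ → ℝ := fun τ => (-ζ √τ / √τ ^ n + n * K √τ / √τ ^ (n + 1)) * (1 / (2 * √τ)) with hp'
  have hz : ∀ τ < r ^ 2, √τ < r := fun τ hτ => (Real.sqrt_lt' hr).2 hτ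
  have hpz : ∀ τ < r ^ 2, p τ = 0 := fun τ hτ => by simp [hp, hK0 _ (hz τ hτ).le]
  have hpz' : ∀ τ < r ^ 2, p' τ = 0 := fun τ hτ => by
    simp [hp', hK0 _ (hz τ hτ).le, hζs _ fun h => absurd h.1 (hz τ hτ).not_gt]
  have hpd : ∀ τ, HasDerivAt p (p' τ) τ := fun τ => by
    rcases lt_or_ge τ (r ^ 2) with h | h
    · rw [hpz' τ h]
      refine (hasDerivAt_const τ (0 : ℝ)).congr_of_eventuallyEq ?_
      filter_upwards [gt_mem_nhds h] with σ hσ using hpz σ hσ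
    · have hτ : 0 < τ := lt_of_lt_of_le (by positivity) h
      have hs : 0 < √τ := Real.sqrt_pos.2 hτ
      have h1 : HasDerivAt (fun y => -K y / y ^ n)
          (-ζ √τ / √τ ^ n + n * K √τ / √τ ^ (n + 1)) √τ := by
        have := ((hKd √τ).neg).div (hasDerivAt_pow n √τ) (pow_ne_zero n hs.ne')
        refine this.congr_deriv ?_
        obtain ⟨m, rfl⟩ : ∃ m, n = m + 1 := ⟨n - 1, by lia⟩
        simp only [Nat.add_sub_cancel, Pi.neg_apply]
        field_simp
        ring
      exact h1.comp τ (Real.hasDerivAt_sqrt hτ.ne')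
  have hpc' : Continuous p' := by
    rw [continuous_iff_continuousAt]
    intro τ
    rcases lt_or_ge τ (r ^ 2) with h | h
    · refine (continuousAt_const (y := (0 : ℝ))).congr ?_
      filter_upwards [gt_mem_nhds h] with σ hσ using (hpz' σ hσ).symm
    · have hτ : 0 < τ := lt_of_lt_of_le (by positivity) h
      have hs : √τ ≠ 0 := (Real.sqrt_pos.2 hτ).ne'
      have hKc : Continuous K := continuous_iff_continuousAt.2 fun y => (hKd y).continuousAt
      have c1 : ContinuousAt (fun τ => √τ) τ := Real.continuous_sqrt.continuousAt
      have c2 : ContinuousAt (fun τ => ζ √τ) τ := (hζ.comp Real.continuous_sqrt).continuousAt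
      have c3 : ContinuousAt (fun τ => K √τ) τ := (hKc.comp Real.continuous_sqrt).continuousAt
      exact ((c2.neg.div (c1.pow n) (pow_ne_zero _ hs)).add
        ((c3.const_mul _).div (c1.pow (n + 1)) (pow_ne_zero _ hs))).mul
        (continuousAt_const.div (c1.const_mul 2) (mul_ne_zero two_ne_zero hs))
  have hpc : Continuous p := continuous_iff_continuousAt.2 fun y => (hpd y).continuousAt
  set G : ℝ → ℝ := fun τ => ∫ σ in (r ^ 2)..τ, p σ with hG
  have hGd : ∀ τ, HasDerivAt G (p τ) τ := fun τ =>
    intervalIntegral.integral_hasDerivAt_right (hpc.intervalIntegrable _ _)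
      hpc.stronglyMeasurable.stronglyMeasurableAtFilter hpc.continuousAt
  have hGm : Antitone G := antitone_of_hasDerivAt_nonpos hGd fun τ =>
    div_nonpos_of_nonpos_of_nonneg (neg_nonpos.2 (hKp _)) (by positivity)
  have hG0 : ∀ τ ≤ r ^ 2, G τ = 0 := fun τ hτ =>
    intervalIntegral.integral_zero_ae (by
      filter_upwards [compl_mem_ae_iff.2 (measure_singleton (r ^ 2))] with σ hσ hσ'
      rw [Set.uIoc_of_ge hτ] at hσ'
      exact hpz σ (lt_of_le_of_ne hσ'.2 hσ))
  have hrR2 : r ^ 2 ≤ R ^ 2 := by gcongr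
  have hGR : -G (R ^ 2) ≤ 2 * ((r ^ (2 - (n : ℝ)) - R ^ (2 - (n : ℝ))) / ((n : ℝ) - 2)) := by
    have hr2 : 0 < r ^ 2 := by positivity
    have hni : (0 : ℝ) ∉ Set.uIcc (r ^ 2) (R ^ 2) := by
      rw [Set.uIcc_of_le hrR2]; exact fun h => absurd h.1 (not_le.2 hr2)
    have hne : (-(n : ℝ) / 2) ≠ -1 := by intro h; linarith
    have e1 : ∀ y : ℝ, 0 < y → (y ^ 2) ^ (-(n : ℝ) / 2 + 1) = y ^ (2 - (n : ℝ)) := fun y hy => by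
      rw [← Real.rpow_natCast y 2, ← Real.rpow_mul hy.le]
      congr 1
      push_cast
      ring
    have e2 : ∫ σ in (r ^ 2)..(R ^ 2), σ ^ (-(n : ℝ) / 2) =
        2 * ((r ^ (2 - (n : ℝ)) - R ^ (2 - (n : ℝ))) / ((n : ℝ) - 2)) := by
      rw [integral_rpow (Or.inr ⟨hne, hni⟩), e1 r hr, e1 R hR]
      have : -(n : ℝ) / 2 + 1 = -(n - 2) / 2 := by ring
      rw [this]
      field_simp
      ring
    rw [← e2, hG, ← intervalIntegral.integral_neg]
    refine intervalIntegral.integral_mono_on hrR2 (hpc.neg.intervalIntegrable _ _)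
      (intervalIntegral.intervalIntegrable_rpow (Or.inr hni)) fun σ hσ => ?_
    have hσ0 : 0 < σ := hr2.trans_le hσ.1
    have hs : √σ ≤ R := Real.sqrt_le_left hR.le |>.2 hσ.2
    have e3 : σ ^ (-(n : ℝ) / 2) = 1 / √σ ^ n := by
      rw [Real.sqrt_eq_rpow, ← Real.rpow_natCast (σ ^ (1 / 2 : ℝ)) n, ← Real.rpow_mul hσ0.le, neg_div,
        Real.rpow_neg hσ0.le, one_div]
      congr 2
      ring
    rw [e3, hp]
    simp only [neg_div, neg_neg]
    exact div_le_div_of_nonneg_right (hKR _ hs) (by positivity)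
  refine ⟨fun x => G (‖x‖ ^ 2), G (R ^ 2) / 2,
    (contDiff_two_of_hasDerivAt hGd hpd hpc').comp (contDiff_norm_sq ℝ), fun x => ?_,
    fun x hx => ?_⟩
  · rw [lapl_comp_norm_sq hGd hpd hpc', hp, hp']
    simp only [Real.sqrt_sq (norm_nonneg x)]
    rcases eq_or_ne ‖x‖ 0 with h | h
    · simp [h, hK0 0 hr.le, hζs 0 fun h => absurd h.1 hr.not_gt]
    · obtain ⟨m, rfl⟩ : ∃ m, n = m + 1 := ⟨n - 1, by lia⟩
      simp only [Nat.add_sub_cancel]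
      field_simp
      ring
  · rw [mem_ball_zero_iff] at hx
    have h1 : G (R ^ 2) ≤ G (‖x‖ ^ 2) := hGm (by gcongr)
    have h2 : G (‖x‖ ^ 2) ≤ 0 := by
      rcases le_total (‖x‖ ^ 2) (r ^ 2) with h | h
      · exact (hG0 _ h).le
      · exact (hGm h).trans_eq (hG0 _ le_rfl)
    rw [abs_le]
    constructor <;> linarith

theorem abs_setIntegral_mul_lapl_le {n : ℕ} {Ω : Set (Euc n)}
    (hΩb : Bornology.IsBounded Ω) {u f : Euc n → ℝ} (hu : MemW21Delta0 n Ω u f)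
    {ψ : Euc n → ℝ} (hψ : ContDiff ℝ 2 ψ) {c B : ℝ} (hB : 0 ≤ B)
    (h : ∀ x ∈ Ω, |ψ x - c| ≤ B) :
    |∫ x in Ω, u x * lapl n ψ x| ≤ B * L1norm n Ω f := by
  obtain ⟨hui, hfi, φ, hφ, hφu, hφf⟩ := hu
  have hint : ∀ k, IntegrableOn (φ k) Ω := fun k =>
    ((hφ k).1.continuous.integrable_of_hasCompactSupport (hφ k).2.1).integrableOn
  have hlc := continuous_lapl hψ
  obtain ⟨C, hC⟩ : ∃ C, ∀ x ∈ closure Ω, ‖lapl n ψ x‖ ≤ C :=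
    hΩb.isCompact_closure.exists_bound_of_continuousOn hlc.continuousOn
  have hC' : ∀ᵐ x ∂(volume.restrict Ω), ‖lapl n ψ x‖ ≤ C := by
    have : ∀ᵐ x ∂(volume.restrict (closure Ω)), ‖lapl n ψ x‖ ≤ C :=
      (ae_restrict_iff' isClosed_closure.measurableSet).2 (ae_of_all _ hC)
    exact ae_mono (Measure.restrict_mono subset_closure le_rfl) this
  have hmul : ∀ {v : Euc n → ℝ}, IntegrableOn v Ω → IntegrableOn (fun x => v x * lapl n ψ x) Ω :=
    fun hv => hv.mul_bdd hlc.aestronglyMeasurable hC'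
  have hbound : ∀ k, |∫ x in Ω, φ k x * lapl n ψ x| ≤
      B * ((∫ x in Ω, |lapl n (φ k) x - f x|) + L1norm n Ω f) := by
    intro k
    have hls := hasCompactSupport_lapl (hφ k).2.1
    have hlk := continuous_lapl (hφ k).contDiff_two
    have e1 : ∫ x in Ω, φ k x * lapl n ψ x = ∫ x, lapl n (φ k) x * (ψ x - c) := by
      rw [setIntegral_eq_integral_of_forall_compl_eq_zero fun x hx => by
        rw [image_eq_zero_of_notMem_tsupport fun h => hx ((hφ k).2.2 h), zero_mul],
        ← integral_lapl_mul_comm (hφ k).contDiff_two hψ (hφ k).2.1]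
      simp_rw [mul_sub]
      rw [integral_sub, integral_mul_const, integral_lapl_eq_zero (hφ k).contDiff_two (hφ k).2.1,
        zero_mul, sub_zero]
      · exact (hlk.mul hψ.continuous).integrable_of_hasCompactSupport hls.mul_right
      · exact (hlk.mul continuous_const).integrable_of_hasCompactSupport hls.mul_right
    rw [e1]
    calc |∫ x, lapl n (φ k) x * (ψ x - c)| ≤ ∫ x, |lapl n (φ k) x * (ψ x - c)| :=
          abs_integral_le_integral_abs
      _ ≤ ∫ x, B * |lapl n (φ k) x| := by
          refine integral_mono ((hlk.mul (hψ.continuous.sub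
            continuous_const)).integrable_of_hasCompactSupport hls.mul_right).abs
            ((hlk.integrable_of_hasCompactSupport hls).abs.const_mul B) fun x => ?_
          rw [abs_mul, mul_comm]
          by_cases hx : x ∈ tsupport (φ k)
          · exact mul_le_mul_of_nonneg_right (h x ((hφ k).2.2 hx)) (abs_nonneg _)
          · simp [lapl_eq_zero_of_notMem_tsupport hx]
      _ ≤ _ := by
          rw [integral_const_mul]
          exact mul_le_mul_of_nonneg_left ((hφ k).integral_abs_lapl_le hfi) hB
  have hlim : Tendsto (fun k => ∫ x in Ω, φ k x * lapl n ψ x) atTop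
      (𝓝 (∫ x in Ω, u x * lapl n ψ x)) := by
    rw [tendsto_iff_dist_tendsto_zero]
    refine squeeze_zero (fun _ => dist_nonneg) (fun k => ?_)
      (by simpa using hφu.mul_const C)
    rw [Real.dist_eq, ← integral_sub (hmul (hint k)) (hmul hui), ← integral_mul_const]
    refine abs_integral_le_integral_abs.trans (integral_mono_ae
      ((hmul (hint k)).sub (hmul hui)).abs (((hint k).sub hui).abs.mul_const C) ?_)
    filter_upwards [hC'] with x hx
    rw [← sub_mul, abs_mul]
    exact mul_le_mul_of_nonneg_left hx (abs_nonneg _)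
  refine le_of_tendsto_of_tendsto' hlim.abs ?_ hbound
  simpa using (hφf.add_const (L1norm n Ω f)).const_mul B

theorem volume_norm_mem_eq_zero {n : ℕ} (hn : n ≠ 0) {E : Set ℝ} {R : ℝ} (hE : volume E = 0)
    (hER : E ⊆ Set.Iio R) : volume {x : Euc n | ‖x‖ ∈ E} = 0 := by
  have : Nonempty (Fin n) := ⟨⟨0, Nat.pos_of_ne_zero hn⟩⟩
  set F := toMeasurable volume E ∩ Set.Iio R with hF
  have hFm : MeasurableSet F := (measurableSet_toMeasurable _ _).inter measurableSet_Iio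
  have hF0 : volume F = 0 := measure_mono_null Set.inter_subset_left (by simpa using hE)
  have hEF : E ⊆ F := Set.subset_inter (subset_toMeasurable _ _) hER
  refine measure_mono_null (t := {x : Euc n | ‖x‖ ∈ F}) (fun x hx => hEF hx) ?_
  have hm : MeasurableSet {x : Euc n | ‖x‖ ∈ F} := measurable_norm hFm
  have hfin : volume {x : Euc n | ‖x‖ ∈ F} ≠ ⊤ :=
    ne_top_of_le_ne_top (measure_ball_lt_top (x := (0 : Euc n)) (r := R)).ne
      (measure_mono fun x hx => by simpa using hx.2)
  have h1 := integral_fun_norm_addHaar (volume : Measure (Euc n)) (F.indicator (1 : ℝ → ℝ))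
  have h2 : ∫ x : Euc n, F.indicator (1 : ℝ → ℝ) ‖x‖ = volume.real {x : Euc n | ‖x‖ ∈ F} := by
    rw [← integral_indicator_one hm]
    rfl
  have h3 : ∫ y in Set.Ioi (0 : ℝ), y ^ (Module.finrank ℝ (Euc n) - 1) •
      F.indicator (1 : ℝ → ℝ) y = 0 := by
    refine integral_eq_zero_of_ae (ae_restrict_of_ae ?_)
    filter_upwards [compl_mem_ae_iff.2 hF0] with y hy
    simp [Set.indicator_of_notMem hy]
  rw [h2, h3, smul_zero, smul_zero] at h1
  exact (measureReal_eq_zero_iff hfin).1 h1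

theorem abs_integral_mul_le_of_radial {n : ℕ} (hn : 3 ≤ n) {r R : ℝ} (hr : 0 < r) (hrR : r < R)
    {u f : Euc n → ℝ} (hu : MemW21Delta0 n (Metric.ball 0 R) u f) {g : ℝ → ℝ}
    (hg : ∀ x, u x = g ‖x‖) {ζ : ℝ → ℝ} (hζ : Continuous ζ) (hζ0 : ∀ y, 0 ≤ ζ y)
    (hζs : ∀ y, y ∉ Set.Ioo r R → ζ y = 0) (hζ1 : ∫ y, ζ y = 1) :
    |∫ y, ζ y * g y| ≤ (r ^ (2 - (n : ℝ)) - R ^ (2 - (n : ℝ))) / ((n : ℝ) - 2) *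
      L1norm n (Metric.ball 0 R) f / (2 * omegaS n) := by
  have hn0 : n ≠ 0 := by lia
  have hn2 : (0 : ℝ) < (n : ℝ) - 2 := by
    have : (3 : ℝ) ≤ n := by exact_mod_cast hn
    linarith
  have : Nonempty (Fin n) := ⟨⟨0, Nat.pos_of_ne_zero hn0⟩⟩
  have hω := omegaS_pos hn0
  have hζ1' : ∫ y in r..R, ζ y = 1 := by
    rw [intervalIntegral.integral_of_le hrR.le, ← hζ1]
    exact setIntegral_eq_integral_of_forall_compl_eq_zero fun y hy =>
      hζs y fun h => hy ⟨h.1, h.2.le⟩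
  obtain ⟨ψ, c, hψ, hψl, hψc⟩ := exists_radial_potential hn hr hrR hζ hζ0 hζs hζ1'
  have hA : 0 ≤ (r ^ (2 - (n : ℝ)) - R ^ (2 - (n : ℝ))) / ((n : ℝ) - 2) :=
    div_nonneg (sub_nonneg.2 (Real.rpow_le_rpow_of_nonpos hr hrR.le (by linarith))) hn2.le
  have h1 := abs_setIntegral_mul_lapl_le Metric.isBounded_ball hu hψ hA hψc
  have h2 : ∫ x in Metric.ball (0 : Euc n) R, u x * lapl n ψ x =
      -(2 * omegaS n) * ∫ y, ζ y * g y := by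
    have e1 : ∫ x in Metric.ball (0 : Euc n) R, u x * lapl n ψ x =
        ∫ x : Euc n, (fun y => g y * (-2 * ζ y / y ^ (n - 1))) ‖x‖ := by
      rw [setIntegral_eq_integral_of_forall_compl_eq_zero fun x hx => by
        rw [hψl, hζs ‖x‖ fun h => hx (by simpa using h.2)]; simp]
      simp_rw [hψl, hg]
    rw [e1, integral_fun_norm_addHaar volume fun y => g y * (-2 * ζ y / y ^ (n - 1)), finrank_euclideanSpace_fin, measureReal_def,
      volume_ball_zero_one hn0, ENNReal.toReal_ofReal (by positivity)]
    have e2 : ∫ y in Set.Ioi (0 : ℝ), y ^ (n - 1) • (g y * (-2 * ζ y / y ^ (n - 1))) =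
        ∫ y in Set.Ioi (0 : ℝ), -2 * (ζ y * g y) := by
      refine setIntegral_congr_fun measurableSet_Ioi fun y (hy : 0 < y) => ?_
      simp only [smul_eq_mul]
      field_simp
    rw [e2, setIntegral_eq_integral_of_forall_compl_eq_zero fun y hy => by
        rw [hζs y fun h => hy (hr.trans h.1)]; simp, integral_const_mul, nsmul_eq_mul, smul_eq_mul]
    field_simp
  rw [h2, abs_mul, abs_neg, abs_of_pos (show (0 : ℝ) < 2 * omegaS n by positivity)] at h1
  rw [le_div_iff₀ (by positivity)]
  linarith

theorem ae_abs_le_of_radial {n : ℕ} (hn : 3 ≤ n) {r R : ℝ} (hr : 0 < r) (hrR : r < R)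
    {u f : Euc n → ℝ} (hu : MemW21Delta0 n (Metric.ball 0 R) u f) {g : ℝ → ℝ}
    (hg : ∀ x, u x = g ‖x‖) :
    ∀ᵐ y, y ∈ Set.Ioo r R → |g y| ≤ (r ^ (2 - (n : ℝ)) - R ^ (2 - (n : ℝ))) / ((n : ℝ) - 2) *
      L1norm n (Metric.ball 0 R) f / (2 * omegaS n) := by
  have hn0 : n ≠ 0 := by lia
  have : Nonempty (Fin n) := ⟨⟨0, Nat.pos_of_ne_zero hn0⟩⟩
  have hgi : IntegrableOn g (Set.Ioo r R) := by
    have h1 : IntegrableOn (fun x : Euc n => g ‖x‖) (Metric.ball 0 R) :=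
      hu.1.congr_fun (fun x _ => hg x) measurableSet_ball
    rw [integrableOn_fun_norm_addHaar, finrank_euclideanSpace_fin] at h1
    have h2 := (h1.mono_set (Set.Ioo_subset_Ioo_left hr.le)).bdd_mul (c := (r ^ (n - 1))⁻¹)
      (f := fun y => (y ^ (n - 1))⁻¹)
      ((measurable_id.pow_const (n - 1)).inv.aestronglyMeasurable) (by
        refine (ae_restrict_iff' measurableSet_Ioo).2 (ae_of_all _ fun y hy => ?_)
        have hy0 := hr.trans hy.1
        rw [Real.norm_of_nonneg (by positivity)]
        have := hy.1.le
        gcongr)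
    refine IntegrableOn.congr_fun h2 (fun y hy => ?_) measurableSet_Ioo
    have hy0 := hr.trans hy.1
    simp only [smul_eq_mul]
    field_simp
  have hgl : LocallyIntegrable ((Set.Ioo r R).indicator g) :=
    ((integrable_indicator_iff measurableSet_Ioo).2 hgi).locallyIntegrable
  let φ : ℕ → ContDiffBump (0 : ℝ) := fun k =>
    { rIn := 1 / ((k : ℝ) + 1) / 2
      rOut := 1 / ((k : ℝ) + 1)
      rIn_pos := half_pos Nat.one_div_pos_of_nat
      rIn_lt_rOut := half_lt_self Nat.one_div_pos_of_nat }
  have hφr : Tendsto (fun k => (φ k).rOut) atTop (𝓝 0) := tendsto_one_div_add_atTop_nhds_zero_nat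
  filter_upwards [ContDiffBump.ae_convolution_tendsto_right_of_locallyIntegrable (μ := volume)
    (φ := φ) (K := 2) hφr (Eventually.of_forall fun k => by simp [φ]; linarith) hgl] with y hy hyI
  rw [Set.indicator_of_mem hyI] at hy
  refine le_of_tendsto hy.abs ?_
  have hpos : 0 < min (y - r) (R - y) := lt_min (sub_pos.2 hyI.1) (sub_pos.2 hyI.2)
  filter_upwards [hφr.eventually (gt_mem_nhds hpos)] with k hk
  have hs : ∀ z, z ∉ Set.Ioo r R → (φ k).normed volume (y - z) = 0 := fun z hz => by
    by_contra h
    have : y - z ∈ Function.support ((φ k).normed volume) := h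
    rw [(φ k).support_normed_eq, mem_ball_zero_iff, Real.norm_eq_abs, abs_lt] at this
    exact hz ⟨by linarith [min_le_left (y - r) (R - y)], by linarith [min_le_right (y - r) (R - y)]⟩
  have e := abs_integral_mul_le_of_radial hn hr hrR hu hg
    (ζ := fun z => (φ k).normed volume (y - z))
    ((φ k).continuous_normed.comp (continuous_const.sub continuous_id))
    (fun z => (φ k).nonneg_normed _) hs (by
      rw [integral_sub_left_eq_self (fun z => (φ k).normed volume z) volume y]
      exact (φ k).integral_normed)
  refine le_trans (le_of_eq ?_) e
  rw [convolution_eq_swap]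
  congr 1
  refine integral_congr_ae (ae_of_all _ fun z => ?_)
  simp only [ContinuousLinearMap.lsmul_apply, smul_eq_mul]
  by_cases hz : z ∈ Set.Ioo r R
  · rw [Set.indicator_of_mem hz]
  · rw [hs z hz, zero_mul, zero_mul]

theorem decRearr_le_of_radial {n : ℕ} (hn : 3 ≤ n) {R : ℝ} (hR : 0 < R)
    {u f : Euc n → ℝ} (hu : MemW21Delta0 n (Metric.ball 0 R) u f) {g : ℝ → ℝ}
    (hg : ∀ x, u x = g ‖x‖) {t : ℝ} (ht : 0 < t)
    (ht' : t ≤ (volume (Metric.ball (0 : Euc n) R)).toReal) :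
    decRearr n (Metric.ball 0 R) u t ≤
      (1 / 2) * NstarV n (volume (Metric.ball (0 : Euc n) R)).toReal t *
        L1norm n (Metric.ball 0 R) f := by
  have hn0 : n ≠ 0 := by lia
  have hn' : (0 : ℝ) < n := by positivity
  have hn2 : (0 : ℝ) < (n : ℝ) - 2 := by
    have : (3 : ℝ) ≤ n := by exact_mod_cast hn
    linarith
  have : Nonempty (Fin n) := ⟨⟨0, Nat.pos_of_ne_zero hn0⟩⟩
  have hω := omegaS_pos hn0
  set κ := omegaS n / n with hκ
  have hκ0 : 0 < κ := by positivity
  have hball : ∀ ρ : ℝ, 0 ≤ ρ → volume (Metric.closedBall (0 : Euc n) ρ) =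
      ENNReal.ofReal (κ * ρ ^ n) := fun ρ hρ => by
    rw [Measure.addHaar_closedBall _ _ hρ, finrank_euclideanSpace_fin, volume_ball_zero_one hn0,
      ← ENNReal.ofReal_mul (by positivity), mul_comm]
  have hV : (volume (Metric.ball (0 : Euc n) R)).toReal = κ * R ^ n := by
    rw [← Measure.addHaar_closedBall_eq_addHaar_ball, hball R hR.le,
      ENNReal.toReal_ofReal (by positivity)]
  have hN := NstarV_nonneg hn ht ht'
  have hf0 : 0 ≤ L1norm n (Metric.ball 0 R) f := integral_nonneg fun x => abs_nonneg _
  rw [hV] at ht' hN ⊢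
  obtain ⟨r, hr, hrt⟩ : ∃ r : ℝ, 0 < r ∧ κ * r ^ n = t := by
    refine ⟨(t / κ) ^ (1 / (n : ℝ)), Real.rpow_pos_of_pos (by positivity) _, ?_⟩
    rw [← Real.rpow_natCast, ← Real.rpow_mul (by positivity), one_div_mul_cancel hn'.ne',
      Real.rpow_one]
    field_simp
  have hvol : volume (Metric.closedBall (0 : Euc n) r) = ENNReal.ofReal t := by
    rw [hball r hr.le, hrt]
  have hNr : (1 / 2) * NstarV n (κ * R ^ n) t * L1norm n (Metric.ball 0 R) f =
      (r ^ (2 - (n : ℝ)) - R ^ (2 - (n : ℝ))) / ((n : ℝ) - 2) *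
      L1norm n (Metric.ball 0 R) f / (2 * omegaS n) := by
    have e : ∀ ρ : ℝ, 0 < ρ → (κ * ρ ^ n) ^ (-(((n : ℝ) - 2) / n)) =
        κ⁻¹ * κ ^ (2 / (n : ℝ)) * ρ ^ (2 - (n : ℝ)) := fun ρ hρ => by
      rw [Real.mul_rpow hκ0.le (by positivity), ← Real.rpow_natCast ρ n, ← Real.rpow_mul hρ.le,
        ← Real.rpow_neg_one κ, ← Real.rpow_add hκ0]
      congr 2 <;> field_simp <;> ring
    have hκn : 0 < κ ^ (2 / (n : ℝ)) := Real.rpow_pos_of_pos hκ0 _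
    have hωκ : omegaS n = n * κ := by rw [hκ]; field_simp
    rw [NstarV_eq hn, ← hκ, ← hrt, e r hr, e R hR, hωκ]
    field_simp
  refine decRearr_le_of_forall_lt (by positivity) fun s hs => ?_
  rcases le_or_gt R r with hRr | hrR
  · rw [← hvol]
    exact measure_mono fun x hx => Metric.closedBall_subset_closedBall hRr
      (Metric.ball_subset_closedBall hx.1)
  · have h1 := ae_abs_le_of_radial hn hr hrR hu hg
    rw [← hNr] at h1
    have h2 : volume {y | y ∈ Set.Ioo r R ∧ s < |g y|} = 0 := by
      refine measure_mono_null (fun y hy => ?_) (mem_ae_iff.1 h1)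
      exact fun hc => absurd (hs.trans hy.2) (not_lt.2 (hc hy.1))
    have h3 := volume_norm_mem_eq_zero hn0 h2 fun y hy => hy.1.2
    calc volume {x ∈ Metric.ball (0 : Euc n) R | s < |u x|} ≤
          volume (Metric.closedBall (0 : Euc n) r ∪
            {x : Euc n | ‖x‖ ∈ {y | y ∈ Set.Ioo r R ∧ s < |g y|}}) := by
          refine measure_mono fun x hx => ?_
          rcases le_or_gt ‖x‖ r with h | h
          · exact Or.inl (by simpa using h)
          · exact Or.inr ⟨⟨h, by simpa using hx.1⟩, by rw [← hg]; exact hx.2⟩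
      _ ≤ ENNReal.ofReal t + 0 := by
          rw [← hvol, ← h3]
          exact measure_union_le _ _
      _ = ENNReal.ofReal t := add_zero _

end RearrangementEstimate

/-- For Ω ⊆ ℝⁿ (n ≥ 3) open and bounded and u ∈ W^{2,1}_{Δ,0}(Ω) with u ≥ 0
a.e. on Ω, or Ω a ball centered at the origin and u radial, one has
u*(t) ≤ (1/2) N*_{|Ω|}(t) ‖Δu‖₁ for 0 < t ≤ |Ω|. -/
theorem stmt_2 (n : ℕ) (hn : 3 ≤ n) (Ω : Set (Euc n)) (hΩo : IsOpen Ω)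
    (hΩb : Bornology.IsBounded Ω) (u f : Euc n → ℝ) (hu : MemW21Delta0 n Ω u f)
    (hspec : (∀ᵐ x ∂(volume.restrict Ω), 0 ≤ u x) ∨
      ((∃ R : ℝ, 0 < R ∧ Ω = Metric.ball (0 : Euc n) R) ∧ ∃ g : ℝ → ℝ, ∀ x, u x = g ‖x‖))
    (t : ℝ) (ht : 0 < t) (ht' : t ≤ (volume Ω).toReal) :
    decRearr n Ω u t ≤ (1 / 2) * NstarV n (volume Ω).toReal t * L1norm n Ω f := by
  rcases hspec with h0 | ⟨⟨R, hR, rfl⟩, g, hg⟩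
  · exact decRearr_le_of_nonneg hn hΩo hΩb hu h0 ht ht'
  · exact decRearr_le_of_radial hn hR hu hg ht ht'
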